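/- There exists a constant c₇ > 0 such that for every cube Q of side length 1 and every f ∈ rbmo(μ) with ‖f‖_{rbmo(μ)} > 0, one has ∫_Q ( exp( |f(x)| / (c₇ ‖f‖_{rbmo(μ)}) ) − 1 ) dμ(x) ≤ 1. -/

import Mathlib

open MeasureTheory Metric Set Filter
open scoped ENNReal NNReal BigOperators Topology

noncomputable section

/-- Euclidean space `ℝ^d`. -/
abbrev Euc (d : ℕ) := EuclideanSpace ℝ (Fin d)

/-- A (closed, axis-parallel) cube in `ℝ^d`, given by its center and side length. -/
structure Cube (d : ℕ) where
  center : Euc d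
  side : ℝ

namespace Cube

/-- The underlying set of a cube. -/
def set {d : ℕ} (Q : Cube d) : Set (Euc d) :=
  {y : Euc d | ∀ i, |y i - Q.center i| ≤ Q.side / 2}

/-- The concentric dilate `αQ` of a cube. -/
def dilate {d : ℕ} (Q : Cube d) (α : ℝ) : Cube d := ⟨Q.center, α * Q.side⟩

end Cube

/-- `Q` is a genuine cube for `μ`: positive side length, centered at a point of `supp μ`. -/
def IsCube {d : ℕ} (μ : Measure (Euc d)) (Q : Cube d) : Prop :=
  0 < Q.side ∧ ∀ r : ℝ, 0 < r → 0 < μ (Metric.ball Q.center r)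

/-- The mean value `f_Q = μ(Q)⁻¹ ∫_Q f dμ`. -/
def cubeAvg {d : ℕ} (μ : Measure (Euc d)) (Q : Cube d) (f : Euc d → ℝ) : ℝ :=
  (μ Q.set).toReal⁻¹ * ∫ x in Q.set, f x ∂μ

/-- `N_{Q,R}`: the smallest positive integer `k` with `2^k ℓ(Q) ≥ ℓ(R)`. -/
def NQR {d : ℕ} (Q R : Cube d) : ℕ :=
  sInf {k : ℕ | 0 < k ∧ R.side ≤ 2 ^ k * Q.side}

/-- The Tolsa coefficient `S_{Q,R} = 1 + ∑_{k=1}^{N_{Q,R}} μ(2^k Q)/ℓ(2^k Q)^n`. -/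
def SQR {d : ℕ} (μ : Measure (Euc d)) (n : ℕ) (Q R : Cube d) : ℝ :=
  1 + ∑ k ∈ Finset.Icc 1 (NQR Q R),
      (μ (Q.dilate (2 ^ k)).set).toReal / (2 ^ k * Q.side) ^ n

/-- `Q` is `(α,β)`-doubling: `μ(αQ) ≤ β μ(Q)`. -/
def IsDoubling {d : ℕ} (μ : Measure (Euc d)) (α β : ℝ) (Q : Cube d) : Prop :=
  μ (Q.dilate α).set ≤ ENNReal.ofReal β * μ Q.set

/-- `Q̃ = 2^N Q`, `N` the smallest non-negative integer making `2^N Q` `(ρ,β)`-doubling. -/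
def tilde {d : ℕ} (μ : Measure (Euc d)) (ρ β : ℝ) (Q : Cube d) : Cube d :=
  Q.dilate (2 ^ sInf {N : ℕ | IsDoubling μ ρ β (Q.dilate (2 ^ N))})

/-- `C` is an `RBMO(μ)` bound for `f` (with parameters `η, ρ, β`). -/
def RBMOBound {d : ℕ} (μ : Measure (Euc d)) (n : ℕ) (η ρ β : ℝ)
    (f : Euc d → ℝ) (C : ℝ) : Prop :=
  (∀ Q : Cube d, IsCube μ Q →
      ∫ x in Q.set, |f x - cubeAvg μ (tilde μ ρ β Q) f| ∂μ
        ≤ C * (μ (Q.dilate η).set).toReal) ∧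
  (∀ Q R : Cube d, IsCube μ Q → IsCube μ R → Q.set ⊆ R.set →
      IsDoubling μ ρ β Q → IsDoubling μ ρ β R →
      |cubeAvg μ Q f - cubeAvg μ R f| ≤ C * SQR μ n Q R)

/-- `f ∈ RBMO(μ)`. -/
def MemRBMO {d : ℕ} (μ : Measure (Euc d)) (n : ℕ) (η ρ β : ℝ) (f : Euc d → ℝ) : Prop :=
  LocallyIntegrable f μ ∧ ∃ C : ℝ, 0 ≤ C ∧ RBMOBound μ n η ρ β f C

/-- The `RBMO(μ)` norm of `f`. -/
def rbmoNorm {d : ℕ} (μ : Measure (Euc d)) (n : ℕ) (η ρ β : ℝ) (f : Euc d → ℝ) : ℝ :=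
  sInf {C : ℝ | 0 ≤ C ∧ RBMOBound μ n η ρ β f C}

/-- `C` is an `rbmo(μ)` (local `RBMO`) bound for `f`. -/
def RbmoLocBound {d : ℕ} (μ : Measure (Euc d)) (n : ℕ) (η ρ β : ℝ)
    (f : Euc d → ℝ) (C : ℝ) : Prop :=
  (∀ Q : Cube d, IsCube μ Q → Q.side ≤ 1 →
      ∫ x in Q.set, |f x - cubeAvg μ (tilde μ ρ β Q) f| ∂μ
        ≤ C * (μ (Q.dilate η).set).toReal) ∧
  (∀ Q R : Cube d, IsCube μ Q → IsCube μ R → Q.side ≤ 1 → Q.set ⊆ R.set →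
      IsDoubling μ ρ β Q → IsDoubling μ ρ β R →
      |cubeAvg μ Q f - cubeAvg μ R f| ≤ C * SQR μ n Q R) ∧
  (∀ Q : Cube d, IsCube μ Q → 1 < Q.side →
      ∫ x in Q.set, |f x| ∂μ ≤ C * (μ (Q.dilate η).set).toReal)

/-- `f ∈ rbmo(μ)`. -/
def MemRbmoLoc {d : ℕ} (μ : Measure (Euc d)) (n : ℕ) (η ρ β : ℝ) (f : Euc d → ℝ) : Prop :=
  LocallyIntegrable f μ ∧ ∃ C : ℝ, 0 ≤ C ∧ RbmoLocBound μ n η ρ β f C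

/-- The `rbmo(μ)` norm of `f`. -/
def rbmoLocNorm {d : ℕ} (μ : Measure (Euc d)) (n : ℕ) (η ρ β : ℝ) (f : Euc d → ℝ) : ℝ :=
  sInf {C : ℝ | 0 ≤ C ∧ RbmoLocBound μ n η ρ β f C}

/-- The data of an `∞`-block: `b = ∑ λ_j a_j`, supported in `R`, with `a_j` supported
in `Q_j ⊂ R` and `‖a_j‖_{L^∞(μ)} ≤ (μ(2Q_j) S_{Q_j,R})⁻¹`, `∑_j |λ_j| < ∞`. -/
structure PreBlock {d : ℕ} (μ : Measure (Euc d)) (n : ℕ) : Type where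
  R : Cube d
  Qs : ℕ → Cube d
  lam : ℕ → ℝ
  a : ℕ → Euc d → ℝ
  isCubeR : IsCube μ R
  isCubeQs : ∀ j, IsCube μ (Qs j)
  subsetQR : ∀ j, (Qs j).set ⊆ R.set
  measA : ∀ j, Measurable (a j)
  suppA : ∀ j, Function.support (a j) ⊆ (Qs j).set
  boundA : ∀ j x, |a j x| ≤ ((μ ((Qs j).dilate 2).set).toReal * SQR μ n (Qs j) R)⁻¹
  summable : Summable fun j => |lam j|

/-- The function determined by a block. -/
def PreBlock.fn {d : ℕ} {μ : Measure (Euc d)} {n : ℕ} (b : PreBlock μ n) : Euc d → ℝ :=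
  fun x => ∑' j, b.lam j * b.a j x

/-- `|b| = ∑_j |λ_j|`. -/
def PreBlock.size {d : ℕ} {μ : Measure (Euc d)} {n : ℕ} (b : PreBlock μ n) : ℝ :=
  ∑' j, |b.lam j|

/-- An `∞`-atomic block: an `∞`-block with vanishing integral. -/
structure AtomicBlock {d : ℕ} (μ : Measure (Euc d)) (n : ℕ) extends PreBlock μ n where
  cancel : ∫ x, (∑' j, lam j * a j x) ∂μ = 0

/-- The function determined by an atomic block. -/
def AtomicBlock.fn {d : ℕ} {μ : Measure (Euc d)} {n : ℕ} (b : AtomicBlock μ n) : Euc d → ℝ :=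
  b.toPreBlock.fn

/-- `|b|_{H¹} = ∑_j |λ_j|`. -/
def AtomicBlock.size {d : ℕ} {μ : Measure (Euc d)} {n : ℕ} (b : AtomicBlock μ n) : ℝ :=
  b.toPreBlock.size

/-- The class of test functions `F(x)` of Tolsa's grand maximal function. -/
def TestFun {d : ℕ} (μ : Measure (Euc d)) (n : ℕ) (x : Euc d) (φ : Euc d → ℝ) : Prop :=
  Integrable φ μ ∧ ContDiff ℝ 1 φ ∧ (∫ y, |φ y| ∂μ) ≤ 1 ∧
  (∀ y, 0 ≤ φ y) ∧ (∀ y, y ≠ x → φ y ≤ (‖y - x‖ ^ n)⁻¹) ∧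
  (∀ y, y ≠ x → ‖fderiv ℝ φ y‖ ≤ (‖y - x‖ ^ (n + 1))⁻¹)

/-- The grand maximal function `M f(x) = sup_{φ ∈ F(x)} |∫ f φ dμ|`. -/
def grandM {d : ℕ} (μ : Measure (Euc d)) (n : ℕ) (f : Euc d → ℝ) (x : Euc d) : ℝ :=
  sSup {r : ℝ | ∃ φ : Euc d → ℝ, TestFun μ n x φ ∧ r = |∫ y, f y * φ y ∂μ|}

/-- The local class `F_loc(x)`: test functions supported in the cube `Q(x,1)`. -/
def TestFunLoc {d : ℕ} (μ : Measure (Euc d)) (n : ℕ) (x : Euc d) (φ : Euc d → ℝ) : Prop :=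
  TestFun μ n x φ ∧ Function.support φ ⊆ (Cube.mk x 1).set

/-- The local grand maximal function `M^{(1)} f(x) = sup_{φ ∈ F_loc(x)} |∫ f φ dμ|`. -/
def grandMLoc {d : ℕ} (μ : Measure (Euc d)) (n : ℕ) (f : Euc d → ℝ) (x : Euc d) : ℝ :=
  sSup {r : ℝ | ∃ φ : Euc d → ℝ, TestFunLoc μ n x φ ∧ r = |∫ y, f y * φ y ∂μ|}

/-- The Orlicz quasi-norm of `u` on the set `E`, for the Orlicz function `P`
(with value `∞` when no admissible constant exists). -/
def orliczNormOn {α : Type*} [MeasurableSpace α] (P : ℝ → ℝ) (lam : Measure α)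
    (E : Set α) (u : α → ℝ) : ℝ≥0∞ :=
  sInf {k : ℝ≥0∞ | 0 < k ∧ k ≠ ∞ ∧
    ∫⁻ x in E, ENNReal.ofReal (P (|u x| / k.toReal)) ∂lam ≤ 1}

/-- The Orlicz quasi-norm of `u`. -/
def orliczNorm {α : Type*} [MeasurableSpace α] (P : ℝ → ℝ) (lam : Measure α)
    (u : α → ℝ) : ℝ≥0∞ :=
  orliczNormOn P lam Set.univ u

/-- `℘(t) = t / log(e+t)`. -/
def wp (t : ℝ) : ℝ := t / Real.log (Real.exp 1 + t)

/-- `℘̃(t) = t · log(e+t)`. -/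
def wpDual (t : ℝ) : ℝ := t * Real.log (Real.exp 1 + t)

/-- `Ξ(t) = e^t − 1`. -/
def XiFun (t : ℝ) : ℝ := Real.exp t - 1

/-- `dν(x) = dμ(x)/log(e+|x|)`. -/
def nuMeas {d : ℕ} (μ : Measure (Euc d)) : Measure (Euc d) :=
  μ.withDensity fun x => ENNReal.ofReal (Real.log (Real.exp 1 + ‖x‖))⁻¹

/-- `dσ(x) = dμ(x)/(1+|x|)^{2n+κ}`. -/
def sigmaMeas {d : ℕ} (μ : Measure (Euc d)) (n : ℕ) (κ : ℝ) : Measure (Euc d) :=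
  μ.withDensity fun x => ENNReal.ofReal (((1 + ‖x‖) ^ (2 * (n : ℝ) + κ))⁻¹)

/-- The unit cube `m + [0,1)^d` of the lattice `ℤ^d`. -/
def latCube (d : ℕ) (m : Fin d → ℤ) : Set (Euc d) :=
  {x : Euc d | ∀ i, (m i : ℝ) ≤ x i ∧ x i < (m i : ℝ) + 1}

/-! ### Doubling scales and decay of densities -/

/-- If `m` grows at most like `r ^ n` and `β > ρ ^ n`, then above every scale `s` there is a dyadic
chain, starting near `s`, that reaches a `(ρ, β)`-doubling scale, and the density `m v / v ^ n`
decays like a power on the way. -/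
theorem exists_doubling_scale_decay (n : ℕ) {ρ β C : ℝ} (hρ : 1 < ρ) (hβ : ρ ^ n < β)
    (hC : 0 < C) :
    ∃ α D : ℝ, 0 < α ∧ α ≤ 1 ∧ 0 < D ∧ ∀ m : ℝ → ℝ, Monotone m → (∀ r, 0 < r → 0 < m r) →
      (∀ r, 0 < r → m r ≤ C * r ^ n) → ∀ s, 0 < s → ∃ (t : ℝ) (k : ℕ), s ≤ t ∧ t ≤ 2 * s ∧
        m (ρ * (2 ^ k * t)) ≤ β * m (2 ^ k * t) ∧
        (∀ i < k, ¬ m (ρ * (2 ^ i * t)) ≤ β * m (2 ^ i * t)) ∧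
        ∀ v, s ≤ v → v ≤ 2 ^ k * t → m v ≤ D * v ^ n * (v / (2 ^ k * t)) ^ α := by
  have hρ0 : 0 < ρ := by linarith
  have hρn : 0 < ρ ^ n := by positivity
  have hβ0 : 0 < β := by linarith
  have hlogρ : 0 < Real.log ρ := Real.log_pos hρ
  have hq : 1 < β / ρ ^ n := by rwa [one_lt_div hρn]
  set α : ℝ := min 1 (Real.log (β / ρ ^ n) / Real.log ρ) with hα
  have hα0 : 0 < α := lt_min one_pos (div_pos (Real.log_pos hq) hlogρ)
  have hα1 : α ≤ 1 := min_le_left _ _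
  have hθ : ρ ^ n / β ≤ ρ⁻¹ ^ α := by
    have h1 : ρ ^ α ≤ β / ρ ^ n := by
      rw [← Real.log_le_log_iff (by positivity) (by positivity), Real.log_rpow hρ0]
      have : α ≤ Real.log (β / ρ ^ n) / Real.log ρ := min_le_right _ _
      rwa [le_div_iff₀ hlogρ] at this
    rw [Real.inv_rpow hρ0.le, ← inv_div]
    exact inv_anti₀ (by positivity) h1
  refine ⟨α, C * ρ ^ (n + 1), hα0, hα1, by positivity, ?_⟩
  intro m hmono hpos hgr s hs
  have hex : ∃ N : ℕ, m (ρ * (ρ ^ N * s)) ≤ β * m (ρ ^ N * s) := by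
    by_contra! hcon
    have hind : ∀ N : ℕ, β ^ N * m s ≤ m (ρ ^ N * s) := by
      intro N
      induction N with
      | zero => simp
      | succ N ih =>
        have h := hcon N
        calc β ^ (N + 1) * m s = β * (β ^ N * m s) := by ring
          _ ≤ β * m (ρ ^ N * s) := by gcongr
          _ ≤ m (ρ * (ρ ^ N * s)) := h.le
          _ = m (ρ ^ (N + 1) * s) := by congr 1; ring
    obtain ⟨N, hN⟩ := pow_unbounded_of_one_lt (C * s ^ n / m s) hq
    have hms := hpos s hs
    rw [div_lt_iff₀ hms, div_pow, div_mul_eq_mul_div, lt_div_iff₀ (by positivity)] at hN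
    have h1 := (hind N).trans (hgr (ρ ^ N * s) (by positivity))
    have h2 : C * (ρ ^ N * s) ^ n = C * s ^ n * (ρ ^ n) ^ N := by
      rw [mul_pow, ← pow_mul, ← pow_mul, mul_comm N n]; ring
    linarith
  classical
  set N := Nat.find hex with hNdef
  have hNd := Nat.find_spec hex
  rw [← hNdef] at hNd
  have hNmin : ∀ i < N, β * m (ρ ^ i * s) < m (ρ * (ρ ^ i * s)) := fun i hi =>
    not_le.1 (Nat.find_min hex hi)
  have hdec : ∀ j ≤ N, m (ρ ^ (N - j) * s) ≤ C * (ρ ^ (N - j) * s) ^ n * (ρ ^ n / β) ^ j := by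
    intro j
    induction j with
    | zero => intro _; simpa using hgr (ρ ^ N * s) (by positivity)
    | succ j ih =>
      intro hj
      have h1 := hNmin (N - (j + 1)) (by omega)
      have h2 : ρ * (ρ ^ (N - (j + 1)) * s) = ρ ^ (N - j) * s := by
        rw [← mul_assoc, ← pow_succ']; congr 2; omega
      rw [h2] at h1
      have h3 := h1.le.trans (ih (by omega))
      rw [← h2] at h3
      have h4 : C * (ρ * (ρ ^ (N - (j + 1)) * s)) ^ n * (ρ ^ n / β) ^ j
          = β * (C * (ρ ^ (N - (j + 1)) * s) ^ n * (ρ ^ n / β) ^ (j + 1)) := by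
        rw [mul_pow ρ, pow_succ]; field_simp
      rw [h4] at h3
      exact le_of_mul_le_mul_left h3 hβ0
  have hdecv : ∀ v, s ≤ v → v ≤ ρ ^ N * s →
      m v ≤ C * ρ ^ (n + 1) * v ^ n * (v / (ρ ^ N * s)) ^ α := by
    intro v hv hvN
    have hv0 : 0 < v := hs.trans_le hv
    obtain ⟨i, hi1, hi2⟩ := exists_nat_pow_near (x := v / s) (y := ρ)
      (by rwa [one_le_div hs]) hρ
    rw [le_div_iff₀ hs] at hi1
    rw [div_lt_iff₀ hs] at hi2
    by_cases hiN : i < N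
    · have h1 := hdec (N - (i + 1)) (by omega)
      rw [show N - (N - (i + 1)) = i + 1 by omega] at h1
      have h2 : (ρ ^ n / β) ^ (N - (i + 1)) ≤ (ρ * (v / (ρ ^ N * s))) ^ α := by
        calc (ρ ^ n / β) ^ (N - (i + 1)) ≤ (ρ⁻¹ ^ α) ^ (N - (i + 1)) := by gcongr
          _ = (ρ⁻¹ ^ (N - (i + 1))) ^ α := by
            rw [← Real.rpow_natCast, ← Real.rpow_natCast, ← Real.rpow_mul (by positivity),
              ← Real.rpow_mul (by positivity), mul_comm]
          _ ≤ (ρ * (v / (ρ ^ N * s))) ^ α := by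
            gcongr
            have : ρ ^ N = ρ ^ (N - (i + 1)) * ρ ^ (i + 1) := by
              rw [← pow_add]; congr 1; omega
            rw [this, inv_pow, mul_div_assoc', le_div_iff₀ (by positivity),
              show (ρ ^ (N - (i + 1)))⁻¹ * (ρ ^ (N - (i + 1)) * ρ ^ (i + 1) * s)
                = ρ * (ρ ^ i * s) by rw [pow_succ' ρ i]; field_simp]
            gcongr
      have h3 : (ρ * (v / (ρ ^ N * s))) ^ α ≤ ρ * (v / (ρ ^ N * s)) ^ α := by
        rw [Real.mul_rpow hρ0.le (by positivity)]
        gcongr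
        simpa using Real.rpow_le_rpow_of_exponent_le hρ.le hα1
      calc m v ≤ m (ρ ^ (i + 1) * s) := hmono hi2.le
        _ ≤ _ := h1
        _ ≤ C * (ρ * v) ^ n * (ρ * (v / (ρ ^ N * s)) ^ α) := by
          have h5 : ρ ^ (i + 1) * s ≤ ρ * v := by
            calc ρ ^ (i + 1) * s = ρ * (ρ ^ i * s) := by ring
              _ ≤ ρ * v := by gcongr
          exact mul_le_mul (mul_le_mul_of_nonneg_left (pow_le_pow_left₀ (by positivity) h5 n)
            hC.le) (h2.trans h3) (by positivity) (by positivity)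
        _ = _ := by rw [mul_pow]; ring
    · have h1 : v = ρ ^ N * s := le_antisymm hvN (le_trans (by
        gcongr
        · exact hρ.le
        · omega) hi1)
      rw [← h1, div_self hv0.ne', Real.one_rpow, mul_one]
      refine (hgr v hv0).trans ?_
      gcongr
      exact le_mul_of_one_le_right hC.le (one_le_pow₀ hρ.le)
  obtain ⟨k, hk1, hk2⟩ := exists_nat_pow_near (x := ρ ^ N) (y := (2 : ℝ))
    (one_le_pow₀ hρ.le) one_lt_two
  set t := ρ ^ N * s / 2 ^ k with ht
  have hkt : 2 ^ k * t = ρ ^ N * s := by rw [ht]; field_simp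
  have ht1 : s ≤ t := by rw [ht, le_div_iff₀ (by positivity), mul_comm]; gcongr
  have ht2 : t ≤ 2 * s := by
    rw [ht, div_le_iff₀ (by positivity)]
    calc ρ ^ N * s ≤ 2 ^ (k + 1) * s := by gcongr
      _ = _ := by ring
  have hex2 : ∃ j : ℕ, m (ρ * (2 ^ j * t)) ≤ β * m (2 ^ j * t) := ⟨k, by rw [hkt]; exact hNd⟩
  have hle : Nat.find hex2 ≤ k := Nat.find_min' hex2 (by rw [hkt]; exact hNd)
  have ht0 : 0 < t := hs.trans_le ht1
  have hle' : 2 ^ Nat.find hex2 * t ≤ ρ ^ N * s := by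
    rw [← hkt]; gcongr; exact one_le_two
  refine ⟨t, Nat.find hex2, ht1, ht2, Nat.find_spec hex2, fun i hi => Nat.find_min hex2 hi, ?_⟩
  intro v hv hv2
  have hv0 : 0 < v := hs.trans_le hv
  refine (hdecv v hv (hv2.trans hle')).trans ?_
  gcongr

/-- A power of `w` truncated at `8`. -/
def truncPow (α w : ℝ) : ℝ := if w ≤ 8 then w ^ α else 0

theorem truncPow_nonneg {α w : ℝ} (hw : 0 ≤ w) : 0 ≤ truncPow α w := by
  unfold truncPow; split_ifs <;> positivity

theorem half_le_truncPow {α w : ℝ} (hα : 0 < α) (hα1 : α ≤ 1) (hw : 1 / 2 ≤ w) (hw8 : w ≤ 8) :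
    1 / 2 ≤ truncPow α w := by
  rw [truncPow, if_pos hw8]
  calc (1 / 2 : ℝ) = (1 / 2) ^ (1 : ℝ) := by simp
    _ ≤ (1 / 2) ^ α := Real.rpow_le_rpow_of_exponent_ge (by norm_num) (by norm_num) hα1
    _ ≤ w ^ α := by gcongr

/-- Truncated powers have uniformly bounded sums along dyadic progressions. -/
theorem exists_sum_truncPow_le {α : ℝ} (hα : 0 < α) :
    ∃ E : ℝ, 0 < E ∧ ∀ w : ℝ, 0 < w → ∀ N : ℕ,
      ∑ k ∈ Finset.Icc 1 N, truncPow α (2 ^ k * w) ≤ E := by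
  set θ : ℝ := 2 ^ α with hθ
  have hθ1 : 1 < θ := Real.one_lt_rpow one_lt_two hα
  set κ := θ / (θ - 1) with hκ
  have hθ2 : 0 < θ - 1 := by linarith
  have hκ0 : 0 < κ := by positivity
  refine ⟨κ * 8 ^ α, by positivity, ?_⟩
  intro w hw N
  have key : ∑ k ∈ Finset.Icc 1 N, truncPow α (2 ^ k * w) ≤ κ * (min (2 ^ N * w) 8) ^ α := by
    induction N with
    | zero => simp; positivity
    | succ N ih =>
      rw [Finset.sum_Icc_succ_top (by omega)]
      by_cases h : 2 ^ (N + 1) * w ≤ 8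
      · have h2 : 2 ^ N * w ≤ 8 := le_trans (by gcongr <;> norm_num) h
        rw [min_eq_left h2] at ih
        rw [min_eq_left h, truncPow, if_pos h]
        have h3 : (2 ^ (N + 1) * w) ^ α = θ * (2 ^ N * w) ^ α := by
          rw [hθ, ← Real.mul_rpow (by norm_num) (by positivity)]; congr 1; ring
        rw [h3]
        have h4 : κ * (θ * (2 ^ N * w) ^ α) = κ * (2 ^ N * w) ^ α + θ * (2 ^ N * w) ^ α := by
          rw [hκ]; field_simp; ring
        linarith
      · rw [truncPow, if_neg h, add_zero]
        refine ih.trans ?_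
        gcongr <;> norm_num
  refine key.trans ?_
  gcongr
  exact min_le_right _ _

/-! ### Chains of concentric balls -/

/-- The number of doublings needed to go from radius `p` to radius `r`. -/
def chainLength (p r : ℝ) : ℕ := sInf {k : ℕ | 0 < k ∧ r ≤ 2 ^ k * p}

/-- The sum of the densities of `m` along the dyadic chain of radii from `p` to `r`. -/
def chainSum (m : ℝ → ℝ) (n : ℕ) (p r : ℝ) : ℝ :=
  ∑ k ∈ Finset.Icc 1 (chainLength p r), m (2 ^ k * p) / (2 ^ k * p) ^ n

theorem two_pow_mul_le_of_le_chainLength {p r : ℝ} (hp : 0 < p) (hpr : p ≤ r) {k : ℕ}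
    (hk : k ≤ chainLength p r) : 2 ^ k * p ≤ 2 * r := by
  rcases Nat.lt_or_ge k 2 with h | h
  · have : (2 : ℝ) ^ k ≤ 2 := by interval_cases k <;> norm_num
    gcongr
  · have h1 : k - 1 ∉ {k : ℕ | 0 < k ∧ r ≤ 2 ^ k * p} :=
      Nat.notMem_of_lt_sInf (show k - 1 < chainLength p r by omega)
    simp only [mem_ofPred_eq, not_and, not_le] at h1
    have h2 := h1 (by omega)
    obtain ⟨j, rfl⟩ : ∃ j, k = j + 1 := ⟨k - 1, by omega⟩
    simp only [Nat.add_sub_cancel] at h2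
    rw [pow_succ]; linarith

theorem chainSum_le_of_truncPow {m : ℝ → ℝ} {n : ℕ} {α E D p r : ℝ} {ι : Type*} (I : Finset ι)
    (q : ι → ℝ) (hq : ∀ i ∈ I, 0 < q i) (hp : 0 < p) (hpr : p ≤ r) (hD : 0 ≤ D)
    (hE : ∀ w : ℝ, 0 < w → ∀ N : ℕ, ∑ k ∈ Finset.Icc 1 N, truncPow α (2 ^ k * w) ≤ E)
    (hm : ∀ v, p ≤ v → v ≤ 2 * r → m v ≤ D * v ^ n * ∑ i ∈ I, truncPow α (v / q i)) :
    chainSum m n p r ≤ D * (I.card * E) := by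
  unfold chainSum
  calc ∑ k ∈ Finset.Icc 1 (chainLength p r), m (2 ^ k * p) / (2 ^ k * p) ^ n
      ≤ ∑ k ∈ Finset.Icc 1 (chainLength p r),
          D * ∑ i ∈ I, truncPow α (2 ^ k * (p / q i)) := by
        refine Finset.sum_le_sum fun k hk => ?_
        rw [Finset.mem_Icc] at hk
        have h1 : p ≤ 2 ^ k * p := le_mul_of_one_le_left hp.le (one_le_pow₀ one_le_two)
        rw [div_le_iff₀ (by positivity)]
        refine (hm _ h1 (two_pow_mul_le_of_le_chainLength hp hpr hk.2)).trans (le_of_eq ?_)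
        simp only [mul_div_assoc]
        ring
    _ = D * ∑ i ∈ I, ∑ k ∈ Finset.Icc 1 (chainLength p r),
          truncPow α (2 ^ k * (p / q i)) := by
        rw [← Finset.mul_sum, Finset.sum_comm]
    _ ≤ D * ∑ i ∈ I, E := by
        gcongr with i hi
        exact hE _ (div_pos hp (hq i hi)) _
    _ = _ := by simp

/-- Every support point `x` and scale `s` has an associated doubling radius `p x s ≥ s`, and the
doubling balls associated with nearby points can be joined, through a common larger doubling ball,
by chains with bounded density sums, provided the density of the smaller one decays up to the
larger scale. -/
theorem exists_doubling_radius_chain {X : Type*} [PseudoMetricSpace X] {S : Set X}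
    {m : X → ℝ → ℝ} (n : ℕ) {ρ β C : ℝ} (hρ : 1 < ρ) (hβ : ρ ^ n < β) (hC : 0 < C)
    (hmono : ∀ x, Monotone (m x))
    (hshift : ∀ x y r, dist x y ≤ r → m x r ≤ m y (2 * r))
    (hpos : ∀ x ∈ S, ∀ r, 0 < r → 0 < m x r)
    (hgr : ∀ x ∈ S, ∀ r, 0 < r → m x r ≤ C * r ^ n) :
    ∃ (α : ℝ) (τ : X → ℝ → ℝ) (κ : X → ℝ → ℕ), 0 < α ∧ α ≤ 1 ∧
      (∀ x ∈ S, ∀ s, 0 < s → s ≤ τ x s ∧ τ x s ≤ 2 * s ∧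
        m x (ρ * (2 ^ κ x s * τ x s)) ≤ β * m x (2 ^ κ x s * τ x s) ∧
        ∀ i < κ x s, ¬ m x (ρ * (2 ^ i * τ x s)) ≤ β * m x (2 ^ i * τ x s)) ∧
      ∀ D, 0 < D → ∃ A, 0 < A ∧ ∀ x ∈ S, ∀ y ∈ S, ∀ s t, 0 < s → s ≤ t → dist x y ≤ t →
        (∀ v, s ≤ v → v ≤ t → m x v ≤ D * v ^ n * (v / t) ^ α) →
        ∃ r, dist x y + 2 ^ κ x s * τ x s ≤ r ∧ 2 ^ κ y t * τ y t ≤ r ∧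
          m y (ρ * r) ≤ β * m y r ∧
          chainSum (m x) n (2 ^ κ x s * τ x s) r ≤ A ∧
          chainSum (m y) n (2 ^ κ y t * τ y t) r ≤ A := by
  obtain ⟨α, D₀, hα, hα1, hD₀, hdec⟩ := exists_doubling_scale_decay n hρ hβ hC
  have hdec' : ∀ x s, ∃ (t : ℝ) (k : ℕ), x ∈ S → 0 < s → s ≤ t ∧ t ≤ 2 * s ∧
        m x (ρ * (2 ^ k * t)) ≤ β * m x (2 ^ k * t) ∧
        (∀ i < k, ¬ m x (ρ * (2 ^ i * t)) ≤ β * m x (2 ^ i * t)) ∧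
        ∀ v, s ≤ v → v ≤ 2 ^ k * t → m x v ≤ D₀ * v ^ n * (v / (2 ^ k * t)) ^ α := by
    intro x s
    by_cases h : x ∈ S ∧ 0 < s
    · obtain ⟨t, k, h'⟩ := hdec (m x) (hmono x) (hpos x h.1) (hgr x h.1) s h.2
      exact ⟨t, k, fun _ _ => h'⟩
    · exact ⟨0, 0, fun h1 h2 => absurd ⟨h1, h2⟩ h⟩
  choose τ κ hτ using hdec'
  refine ⟨α, τ, κ, hα, hα1, fun x hx s hs => ?_, fun D hD => ?_⟩
  · obtain ⟨h1, h2, h3, h4, -⟩ := hτ x s hx hs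
    exact ⟨h1, h2, h3, h4⟩
  obtain ⟨E, hE0, hE⟩ := exists_sum_truncPow_le hα
  set D₁ : ℝ := D₀ * 2 ^ (n + 1) + 2 * C + D with hD₁
  have hD₁0 : 0 < D₁ := by positivity
  refine ⟨D₁ * (4 * E), by positivity, ?_⟩
  intro x hx y hy s t hs hst hxy hxt
  have ht : 0 < t := hs.trans_le hst
  set px := 2 ^ κ x s * τ x s with hpx
  set py := 2 ^ κ y t * τ y t with hpy
  have hle : ∀ z ∈ S, ∀ w, 0 < w → w ≤ 2 ^ κ z w * τ z w := fun z hz w hw =>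
    (hτ z w hz hw).1.trans (le_mul_of_one_le_left (hw.le.trans (hτ z w hz hw).1)
      (one_le_pow₀ one_le_two))
  have hspx : s ≤ px := hle x hx s hs
  have htpy : t ≤ py := hle y hy t ht
  have hpx0 : 0 < px := hs.trans_le hspx
  have hpy0 : 0 < py := ht.trans_le htpy
  have hPx : px ≤ max px py := le_max_left _ _
  have hPy : py ≤ max px py := le_max_right _ _
  set u := 4 * max px py with hu
  have hu0 : 0 < u := by linarith
  set r := 2 ^ κ y u * τ y u with hr
  have hur : u ≤ r := hle y hy u hu0
  have hr0 : 0 < r := hu0.trans_le hur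
  have hdx := (hτ x s hx hs).2.2.2.2
  have hdy := (hτ y t hy ht).2.2.2.2
  obtain ⟨-, -, hdbl, -, hdr⟩ := hτ y u hy hu0
  have htn : ∀ v q : ℝ, 0 < v → 0 < q → 0 ≤ truncPow α (v / q) := fun v q hv hq =>
    truncPow_nonneg (by positivity)
  have hcomp : ∀ z ∈ S, ∀ v q : ℝ, 0 < v → 0 < q → q ≤ 2 * v → v ≤ 8 * q →
      m z v ≤ D₁ * v ^ n * truncPow α (v / q) := by
    intro z hz v q hv hq h1 h2
    have h3 : 1 / 2 ≤ truncPow α (v / q) := half_le_truncPow hα hα1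
      (by rw [le_div_iff₀ hq]; linarith) (by rw [div_le_iff₀ hq]; linarith)
    have h4 : 0 < D₀ * 2 ^ (n + 1) := by positivity
    calc m z v ≤ C * v ^ n := hgr z hz v hv
      _ = (2 * C) * v ^ n * (1 / 2) := by ring
      _ ≤ D₁ * v ^ n * truncPow α (v / q) := by
        gcongr
        linarith
  have hdirect : ∀ (z : X) (v q B : ℝ), 0 < v → 0 < q → v ≤ 8 * q → B ≤ D₁ →
      m z v ≤ B * v ^ n * (v / q) ^ α → m z v ≤ D₁ * v ^ n * truncPow α (v / q) := by
    intro z v q B hv hq h1 hB h2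
    rw [truncPow, if_pos (by rw [div_le_iff₀ hq]; linarith)]
    refine h2.trans ?_
    gcongr
  have hD₀' : D₀ * 2 ^ (n + 1) ≤ D₁ := by rw [hD₁]; linarith
  have hD₀1 : D₀ ≤ D₁ := by
    refine le_trans ?_ hD₀'
    exact le_mul_of_one_le_right hD₀.le (one_le_pow₀ one_le_two)
  have hshift' : ∀ (z z' : X) (v q : ℝ), 0 < v → 0 < q → v ≤ 8 * q → dist z z' ≤ v →
      m z' (2 * v) ≤ D₀ * (2 * v) ^ n * (2 * v / q) ^ α →
      m z v ≤ D₁ * v ^ n * truncPow α (v / q) := by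
    intro z z' v q hv hq h1 hz h2
    refine hdirect z v q (D₀ * 2 ^ (n + 1)) hv hq h1 hD₀' ?_
    refine (hshift z z' v hz).trans (h2.trans ?_)
    have h3 : (2 * v / q) ^ α ≤ 2 * (v / q) ^ α := by
      rw [mul_div_assoc, Real.mul_rpow (by norm_num) (by positivity)]
      gcongr
      simpa using Real.rpow_le_rpow_of_exponent_le one_le_two hα1
    calc D₀ * (2 * v) ^ n * (2 * v / q) ^ α ≤ D₀ * (2 * v) ^ n * (2 * (v / q) ^ α) := by gcongr
      _ = _ := by rw [mul_pow]; ring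
  let q : Fin 4 → ℝ := ![px, py, r, t]
  have hq : ∀ i ∈ (Finset.univ : Finset (Fin 4)), 0 < q i := by
    intro i _
    fin_cases i <;> assumption
  have hsum : ∀ (z : X) (v : ℝ), 0 < v →
      (m z v ≤ D₁ * v ^ n * truncPow α (v / px) ∨ m z v ≤ D₁ * v ^ n * truncPow α (v / py) ∨
        m z v ≤ D₁ * v ^ n * truncPow α (v / r) ∨ m z v ≤ D₁ * v ^ n * truncPow α (v / t)) →
      m z v ≤ D₁ * v ^ n * ∑ i, truncPow α (v / q i) := by
    intro z v hv h
    have h1 := htn v px hv hpx0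
    have h2 := htn v py hv hpy0
    have h3 := htn v r hv hr0
    have h4 := htn v t hv ht
    have hs4 : ∑ i, truncPow α (v / q i) = truncPow α (v / px) + truncPow α (v / py) +
        truncPow α (v / r) + truncPow α (v / t) := by
      simp [q, Fin.sum_univ_four]
    rw [hs4]
    rcases h with h | h | h | h <;> refine h.trans ?_ <;> gcongr <;> linarith
  have hfin : ∀ z p, 0 < p → p ≤ r → (∀ v, p ≤ v → v ≤ 2 * r →
      (m z v ≤ D₁ * v ^ n * truncPow α (v / px) ∨ m z v ≤ D₁ * v ^ n * truncPow α (v / py) ∨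
        m z v ≤ D₁ * v ^ n * truncPow α (v / r) ∨ m z v ≤ D₁ * v ^ n * truncPow α (v / t))) →
      chainSum (m z) n p r ≤ D₁ * (4 * E) := by
    intro z p hp hpr h
    have := chainSum_le_of_truncPow (m := m z) (n := n) (D := D₁) Finset.univ q hq hp hpr
      hD₁0.le hE (fun v hv hv2 => hsum z v (hp.trans_le hv) (h v hv hv2))
    simpa using this
  refine ⟨r, by linarith, by linarith, hdbl, hfin x px hpx0 (by linarith) ?_,
    hfin y py hpy0 (by linarith) ?_⟩
  · intro v hv hv2
    have hv0 : 0 < v := hpx0.trans_le hv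
    rcases le_or_gt u v with h | h
    · right; right; left
      rcases le_or_gt (2 * v) r with h' | h'
      · exact hshift' x y v r hv0 hr0 (by linarith) (by linarith) (hdr _ (by linarith) h')
      · exact hcomp x hx v r hv0 hr0 h'.le (by linarith)
    · rcases le_total py px with hP | hP
      · rw [hu, max_eq_left hP] at h
        left
        exact hcomp x hx v px hv0 hpx0 (by linarith) (by linarith)
      · rw [hu, max_eq_right hP] at h
        rcases le_or_gt v t with h' | h'
        · right; right; right
          exact hdirect x v t D hv0 ht (by linarith) (by rw [hD₁]; linarith [show 0 < D₀ * 2 ^ (n + 1) by positivity])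
            (hxt v (hspx.trans hv) h')
        · right; left
          rcases le_or_gt (2 * v) py with h'' | h''
          · exact hshift' x y v py hv0 hpy0 (by linarith) (by linarith) (hdy _ (by linarith) h'')
          · exact hcomp x hx v py hv0 hpy0 h''.le (by linarith)
  · intro v hv hv2
    have hv0 : 0 < v := hpy0.trans_le hv
    rcases le_or_gt u v with h | h
    · right; right; left
      rcases le_or_gt v r with h' | h'
      · exact hdirect y v r D₀ hv0 hr0 (by linarith) hD₀1 (hdr v h h')
      · exact hcomp y hy v r hv0 hr0 (by linarith) (by linarith)
    · rcases le_total py px with hP | hP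
      · rw [hu, max_eq_left hP] at h
        left
        rcases le_or_gt (2 * v) px with h'' | h''
        · exact hshift' y x v px hv0 hpx0 (by linarith) (by rw [dist_comm]; linarith)
            (hdx _ (by linarith) h'')
        · exact hcomp y hy v px hv0 hpx0 h''.le (by linarith)
      · rw [hu, max_eq_right hP] at h
        right; left
        exact hcomp y hy v py hv0 hpy0 (by linarith) (by linarith)

/-! ### Decay along non-doubling scales -/

/-- If no scale strictly between `s` and `s / 2 ^ J` is `(2 ^ q, 2 ^ (q * (d + 1)))`-doubling, then
`m` decays like `r ^ (d + 1)` along these scales. -/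
theorem le_of_forall_not_doubling {m : ℝ → ℝ} (hmono : Monotone m) (hnn : ∀ r, 0 ≤ m r) {q d J : ℕ}
    {s : ℝ} (hs : 0 < s)
    (hnd : ∀ i, 0 < i → i < J → ¬ m (2 ^ q * (s / 2 ^ i)) ≤ 2 ^ (q * (d + 1)) * m (s / 2 ^ i)) :
    ∀ i, i < J ∨ i = 0 → m (s / 2 ^ i) ≤ m s * 2 ^ (q * (d + 1)) * ((1 / 2) ^ i) ^ (d + 1) := by
  intro i
  induction i using Nat.strong_induction_on with
  | _ i ih =>
    intro hi
    rcases Nat.lt_or_ge i q with h | h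
    · have h1 : m (s / 2 ^ i) ≤ m s := hmono (div_le_self hs.le (one_le_pow₀ one_le_two))
      have h2 : (1 : ℝ) ≤ 2 ^ (q * (d + 1)) * ((1 / 2) ^ i) ^ (d + 1) := by
        rw [pow_mul, ← mul_pow]
        refine one_le_pow₀ ?_
        rw [one_div, inv_pow, ← div_eq_mul_inv, one_le_div (by positivity)]
        exact pow_le_pow_right₀ one_le_two h.le
      calc m (s / 2 ^ i) ≤ m s * 1 := by rw [mul_one]; exact h1
        _ ≤ m s * (2 ^ (q * (d + 1)) * ((1 / 2) ^ i) ^ (d + 1)) := by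
          gcongr
          exact hnn s
        _ = _ := by ring
    · rcases Nat.eq_zero_or_pos i with rfl | hi0
      · simpa using le_mul_of_one_le_right (hnn s) (one_le_pow₀ one_le_two)
      · have hJ : i < J := hi.resolve_right hi0.ne'
        have h1 := (not_le.1 (hnd i hi0 hJ)).le
        have h2 : 2 ^ q * (s / 2 ^ i) = s / 2 ^ (i - q) := by
          have : (2 : ℝ) ^ i = 2 ^ (i - q) * 2 ^ q := by rw [← pow_add]; congr 1; omega
          rw [this]; field_simp
        rw [h2] at h1
        rcases Nat.eq_zero_or_pos q with rfl | hq0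
        · simp only [zero_mul, pow_zero, one_mul, Nat.sub_zero] at h1
          have h4 := not_le.1 (hnd i hi0 hJ)
          simp at h4
        have h3 := h1.trans (ih (i - q) (by omega) (Or.inl (by omega)))
        have h4 : m s * 2 ^ (q * (d + 1)) * ((1 / 2) ^ (i - q)) ^ (d + 1)
            = 2 ^ (q * (d + 1)) * (m s * 2 ^ (q * (d + 1)) * ((1 / 2) ^ i) ^ (d + 1)) := by
          have : ((1 : ℝ) / 2) ^ i = (1 / 2) ^ (i - q) * (1 / 2) ^ q := by
            rw [← pow_add]; congr 1; omega
          have h5 : (2 : ℝ) ^ (q * (d + 1)) * ((1 / 2) ^ q) ^ (d + 1) = 1 := by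
            rw [pow_mul, ← mul_pow, ← mul_pow]; norm_num
          rw [this, mul_pow]
          linear_combination (-(m s * 2 ^ (q * (d + 1)) * ((1 / 2) ^ (i - q)) ^ (d + 1))) * h5
        rw [h4] at h3
        exact le_of_mul_le_mul_left h3 (by positivity)

theorem density_decay_of_forall_not_doubling {m : ℝ → ℝ} (hmono : Monotone m) (hnn : ∀ r, 0 ≤ m r)
    {n q d J : ℕ} (hnd' : n ≤ d) {s C α : ℝ} (hα : α ≤ 1) (hs : 0 < s) (hC : 0 ≤ C)
    (hgr : m s ≤ C * s ^ n)
    (hnd : ∀ i, 0 < i → i < J → ¬ m (2 ^ q * (s / 2 ^ i)) ≤ 2 ^ (q * (d + 1)) * m (s / 2 ^ i))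
    {v : ℝ} (hv : s / 2 ^ J ≤ v) (hvs : v ≤ s) :
    m v ≤ C * 2 ^ (q * (d + 1)) * 4 ^ (n + 1) * v ^ n * (v / s) ^ α := by
  have hv0 : 0 < v := lt_of_lt_of_le (by positivity) hv
  obtain ⟨i, hi, hi1, hi2⟩ : ∃ i : ℕ, (i < J ∨ i = 0) ∧ v ≤ s / 2 ^ i ∧ s / 2 ^ i ≤ 4 * v := by
    obtain ⟨i, h1, h2⟩ := exists_nat_pow_near (x := s / v) (y := (2 : ℝ))
      (by rwa [one_le_div hv0]) one_lt_two
    rw [le_div_iff₀ hv0] at h1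
    rw [div_lt_iff₀ hv0, pow_succ] at h2
    rcases Nat.lt_or_ge i J with h | h
    · refine ⟨i, Or.inl h, ?_, ?_⟩
      · rw [le_div_iff₀ (by positivity)]; linarith
      · rw [div_le_iff₀ (by positivity)]; nlinarith [show (0 : ℝ) < 2 ^ i by positivity]
    · rcases Nat.eq_zero_or_pos J with hJ | hJ
      · subst hJ
        exact ⟨0, Or.inr rfl, by simpa using hvs, by simp at hv; simp; linarith⟩
      · obtain ⟨J, rfl⟩ : ∃ j, J = j + 1 := ⟨J - 1, by omega⟩
        refine ⟨J, Or.inl (by omega), ?_, ?_⟩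
        · rw [le_div_iff₀ (by positivity)]
          have : (2 : ℝ) ^ J ≤ 2 ^ i := pow_le_pow_right₀ one_le_two (by omega)
          nlinarith
        · rw [pow_succ, div_le_iff₀ (by positivity)] at hv
          rw [div_le_iff₀ (by positivity)]
          nlinarith [show (0 : ℝ) < 2 ^ J by positivity]
  have h1 := (hmono hi1).trans (le_of_forall_not_doubling hmono hnn hs hnd i hi)
  have h2 : (((1 : ℝ) / 2) ^ i) ^ (d + 1) ≤ ((1 / 2) ^ i) ^ (n + 1) :=
    pow_le_pow_of_le_one (by positivity) (pow_le_one₀ (by norm_num) (by norm_num)) (by omega)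
  have h3 : v / s ≤ (v / s) ^ α := by
    simpa using Real.rpow_le_rpow_of_exponent_ge (by positivity : 0 < v / s)
      (by rw [div_le_one hs]; exact hvs) hα
  have h4 : s * (1 / 2) ^ i ≤ 4 * v := by
    rw [one_div, inv_pow, ← div_eq_mul_inv]; exact hi2
  have h5 : (s * (1 / 2) ^ i) ^ (n + 1) ≤ (4 * v) ^ (n + 1) := by gcongr
  calc m v ≤ m s * 2 ^ (q * (d + 1)) * ((1 / 2) ^ i) ^ (d + 1) := h1
    _ ≤ C * s ^ n * 2 ^ (q * (d + 1)) * ((1 / 2) ^ i) ^ (n + 1) := by gcongr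
    _ = C * 2 ^ (q * (d + 1)) * (s * (1 / 2) ^ i) ^ (n + 1) / s := by
      rw [mul_pow, pow_succ s n]; field_simp
    _ ≤ C * 2 ^ (q * (d + 1)) * (4 * v) ^ (n + 1) / s := by gcongr
    _ = C * 2 ^ (q * (d + 1)) * 4 ^ (n + 1) * v ^ n * (v / s) := by rw [mul_pow]; ring
    _ ≤ _ := by gcongr

/-- Almost every point is the center of arbitrarily small doubling balls. -/
theorem ae_exists_doubling {d : ℕ} (ν : Measure (Fin d → ℝ)) [IsLocallyFiniteMeasure ν] (q : ℕ) :
    ∀ᵐ x ∂ν, ∀ s, 0 < s → ∀ J : ℕ, ∃ j, J ≤ j ∧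
      ν.real (closedBall x (2 ^ q * (s / 2 ^ j)))
        ≤ 2 ^ (q * (d + 1)) * ν.real (closedBall x (s / 2 ^ j)) := by
  filter_upwards [(Besicovitch.vitaliFamily ν).ae_tendsto_rnDeriv volume,
    Measure.rnDeriv_lt_top (volume : Measure (Fin d → ℝ)) ν,
    (Besicovitch.vitaliFamily ν).ae_eventually_measure_pos] with x hx hlt hpos s hs J
  by_contra! hcon
  set σ := s / 2 ^ J with hσ
  have hσ0 : 0 < σ := by positivity
  have hmono : Monotone fun r => ν.real (closedBall x r) := fun a b hab =>
    measureReal_mono (closedBall_subset_closedBall hab) measure_closedBall_lt_top.ne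
  have hσi : ∀ i : ℕ, σ / 2 ^ i = s / 2 ^ (J + i) := fun i => by
    rw [hσ, pow_add, div_div]
  have hdec := fun i : ℕ => le_of_forall_not_doubling (m := fun r => ν.real (closedBall x r))
    hmono (fun _ => measureReal_nonneg) (q := q) (d := d) (J := i + 1) hσ0
    (fun k _ _ => by
      rw [hσi, not_le]; exact hcon (J + k) (by omega)) i (Or.inl (by omega))
  have hto : Tendsto (fun i : ℕ => closedBall x (σ / 2 ^ i)) atTop
      ((Besicovitch.vitaliFamily ν).filterAt x) := by
    refine (Besicovitch.tendsto_filterAt ν x).comp ?_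
    refine tendsto_nhdsWithin_iff.2 ⟨?_, Eventually.of_forall fun i => by
      rw [mem_Ioi]; positivity⟩
    have := (tendsto_pow_atTop_nhds_zero_of_lt_one (r := (1 / 2 : ℝ)) (by norm_num)
      (by norm_num)).const_mul σ
    rw [mul_zero] at this
    refine this.congr fun i => ?_
    rw [one_div, inv_pow, ← div_eq_mul_inv]
  obtain ⟨L, hL1, hL2⟩ := ENNReal.lt_iff_exists_nnreal_btwn.1 hlt
  have hev := ((hx.comp hto).eventually_lt_const hL1).and (hto.eventually hpos)
  obtain ⟨i₀, hi₀⟩ := eventually_atTop.1 hev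
  set c := ν.real (closedBall x σ) * 2 ^ (q * (d + 1)) with hc
  have hbd : ∀ i, i₀ ≤ i → (2 * σ) ^ d * 2 ^ i ≤ L * c := by
    intro i hi
    obtain ⟨h1, h2⟩ := hi₀ i hi
    simp only [Function.comp_apply] at h1
    have h3 := (ENNReal.div_lt_iff (Or.inl h2.ne') (Or.inl measure_closedBall_lt_top.ne)).1 h1
    rw [Real.volume_pi_closedBall _ (by positivity), Fintype.card_fin] at h3
    have h4 : (2 * (σ / 2 ^ i)) ^ d ≤ L * ν.real (closedBall x (σ / 2 ^ i)) := by
      have := (ENNReal.toReal_mono (ENNReal.mul_ne_top ENNReal.coe_ne_top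
        measure_closedBall_lt_top.ne) h3.le)
      rwa [ENNReal.toReal_ofReal (by positivity), ENNReal.toReal_mul, ENNReal.coe_toReal] at this
    have h5 := h4.trans (mul_le_mul_of_nonneg_left (hdec i) L.2)
    have h6 : (2 * (σ / 2 ^ i)) ^ d = (2 * σ) ^ d * 2 ^ i * ((1 / 2) ^ i) ^ (d + 1) := by
      have : σ / 2 ^ i = σ * (1 / 2) ^ i := by rw [one_div, inv_pow, ← div_eq_mul_inv]
      rw [this, pow_succ, ← mul_assoc, mul_pow]
      have h7 : (2 : ℝ) ^ i * (1 / 2) ^ i = 1 := by rw [← mul_pow]; norm_num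
      linear_combination (-((2 ^ d * σ ^ d) * ((1 / 2 : ℝ) ^ i) ^ d)) * h7
    rw [h6, ← mul_assoc] at h5
    exact le_of_mul_le_mul_right h5 (by positivity)
  have hK : 0 < (2 * σ) ^ d := by positivity
  obtain ⟨i, hi⟩ := pow_unbounded_of_one_lt (L * c / (2 * σ) ^ d) (one_lt_two (α := ℝ))
  have h1 := hbd (max i i₀) (le_max_right _ _)
  rw [div_lt_iff₀ hK] at hi
  have h2 : (2 : ℝ) ^ i ≤ 2 ^ (max i i₀) := pow_le_pow_right₀ one_le_two (le_max_left _ _)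
  nlinarith

/-! ### The John–Nirenberg iteration -/

/-- The support of a measure: points all of whose closed balls have positive measure. -/
def posBallSet {X : Type*} [PseudoMetricSpace X] [MeasurableSpace X] (ν : Measure X) : Set X :=
  {x | ∀ r, 0 < r → 0 < ν (closedBall x r)}

theorem ae_mem_posBallSet {d : ℕ} (ν : Measure (Fin d → ℝ)) [IsLocallyFiniteMeasure ν] :
    ∀ᵐ x ∂ν, x ∈ posBallSet ν := by
  filter_upwards [(Besicovitch.vitaliFamily ν).ae_eventually_measure_pos] with x hx r hr
  have h := ((Besicovitch.tendsto_filterAt ν x).eventually hx).and (Ioo_mem_nhdsGT hr)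
  obtain ⟨r', h1, h2⟩ := h.exists
  exact h1.trans_le (measure_mono (closedBall_subset_closedBall h2.2.le))

theorem enorm_sub_mul_measure_le {X : Type*} [MeasurableSpace X] {ν : Measure X} {f : X → ℝ}
    (hf : AEStronglyMeasurable f ν) (s : Set X) (b c : ℝ) :
    ‖b - c‖ₑ * ν s ≤ ∫⁻ y in s, ‖f y - b‖ₑ ∂ν + ∫⁻ y in s, ‖f y - c‖ₑ ∂ν := by
  have h : AEMeasurable (fun y => ‖f y - b‖ₑ) (ν.restrict s) :=
    (hf.restrict.sub aestronglyMeasurable_const).enorm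
  rw [← lintegral_add_left' h, ← setLIntegral_const]
  refine lintegral_mono fun y => ?_
  calc ‖b - c‖ₑ = ‖(f y - c) - (f y - b)‖ₑ := by congr 1; ring
    _ ≤ ‖f y - c‖ₑ + ‖f y - b‖ₑ := enorm_sub_le
    _ = _ := add_comm _ _

theorem lintegral_enorm_sub_le {X : Type*} [MeasurableSpace X] {ν : Measure X} (f : X → ℝ)
    (s : Set X) (b c : ℝ) :
    ∫⁻ y in s, ‖f y - c‖ₑ ∂ν ≤ ∫⁻ y in s, ‖f y - b‖ₑ ∂ν + ‖b - c‖ₑ * ν s := by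
  rw [← setLIntegral_const, ← lintegral_add_right _ measurable_const]
  refine lintegral_mono fun y => ?_
  calc ‖f y - c‖ₑ = ‖(f y - b) + (b - c)‖ₑ := by congr 1; ring
    _ ≤ _ := enorm_add_le _ _

theorem measure_le_ofReal_mul_of_real_le {X : Type*} [MeasurableSpace X] {ν : Measure X}
    {s t : Set X} {b : ℝ} (hs : ν s ≠ ∞) (ht : ν t ≠ ∞) (h : ν.real s ≤ b * ν.real t)
    (hb : 0 ≤ b) : ν s ≤ ENNReal.ofReal b * ν t := by
  rw [← ENNReal.ofReal_toReal hs, ← ENNReal.ofReal_toReal ht, ← ENNReal.ofReal_mul hb]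
  exact ENNReal.ofReal_le_ofReal h

section JohnNirenberg

variable {d n q : ℕ} {ν : Measure (Fin d → ℝ)} [IsLocallyFiniteMeasure ν] {f : (Fin d → ℝ) → ℝ}
  {a : (Fin d → ℝ) → ℝ → ℝ} {M A C Λ α : ℝ}

/-- A point where some small doubling ball has an exceptional value `a x r` admits a stopping
radius. -/
theorem exists_stopping_radius (hnd : n ≤ d) (hα : α ≤ 1) (hC : 0 < C)
    (hgr : ∀ x ∈ posBallSet ν, ∀ r, 0 < r → ν.real (closedBall x r) ≤ C * r ^ n)
    (hcmp : ∀ x ∈ posBallSet ν, ∀ y ∈ posBallSet ν, ∀ s t, 0 < s → s ≤ t → dist x y ≤ t →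
      (∀ v, s ≤ v → v ≤ t → ν.real (closedBall x v)
        ≤ C * 2 ^ (q * (d + 1)) * 4 ^ (n + 1) * v ^ n * (v / t) ^ α) →
      |a x s - a y t| ≤ A * M)
    {x x₀ : Fin d → ℝ} {s₀ B : ℝ} (hx : x ∈ posBallSet ν) (hx₀ : x₀ ∈ posBallSet ν) (hs₀ : 0 < s₀)
    (hd : dist x x₀ ≤ s₀)
    (hex : ∃ j : ℕ, ν.real (closedBall x (2 ^ q * (s₀ / 2 ^ j)))
      ≤ 2 ^ (q * (d + 1)) * ν.real (closedBall x (s₀ / 2 ^ j)) ∧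
        B < |a x (s₀ / 2 ^ j) - a x₀ s₀|) (hB : 0 ≤ B) :
    ∃ r, 0 < r ∧ r ≤ s₀ ∧ ν.real (closedBall x (2 ^ q * r))
      ≤ 2 ^ (q * (d + 1)) * ν.real (closedBall x r) ∧
      B < |a x r - a x₀ s₀| ∧ |a x r - a x₀ s₀| ≤ B + A * M := by
  classical
  have hmono : Monotone fun r => ν.real (closedBall x r) := fun a b hab =>
    measureReal_mono (closedBall_subset_closedBall hab) measure_closedBall_lt_top.ne
  set j := Nat.find hex with hj
  obtain ⟨hj1, hj2⟩ := Nat.find_spec hex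
  rw [← hj] at hj1 hj2
  have hmin : ∀ i < j, ν.real (closedBall x (2 ^ q * (s₀ / 2 ^ i)))
      ≤ 2 ^ (q * (d + 1)) * ν.real (closedBall x (s₀ / 2 ^ i)) →
      |a x (s₀ / 2 ^ i) - a x₀ s₀| ≤ B := fun i hi h => by
    by_contra hcon
    exact Nat.find_min hex hi ⟨h, not_le.1 hcon⟩
  have hdecay : ∀ i ≤ j, (∀ k, i < k → k < j → ¬ ν.real (closedBall x (2 ^ q * (s₀ / 2 ^ k)))
      ≤ 2 ^ (q * (d + 1)) * ν.real (closedBall x (s₀ / 2 ^ k))) →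
      ∀ v, s₀ / 2 ^ j ≤ v → v ≤ s₀ / 2 ^ i → ν.real (closedBall x v)
        ≤ C * 2 ^ (q * (d + 1)) * 4 ^ (n + 1) * v ^ n * (v / (s₀ / 2 ^ i)) ^ α := by
    intro i hij hno v hv1 hv2
    have hdiv : ∀ k : ℕ, s₀ / 2 ^ i / 2 ^ k = s₀ / 2 ^ (i + k) := fun k => by
      rw [pow_add, div_div]
    refine density_decay_of_forall_not_doubling (m := fun r => ν.real (closedBall x r)) (J := j - i)
      hmono (fun _ => measureReal_nonneg) hnd hα (by positivity) hC.le
      (hgr x hx _ (by positivity)) (fun k hk1 hk2 => ?_) ?_ hv2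
    · rw [hdiv]; exact hno (i + k) (by omega) (by omega)
    · rw [hdiv, Nat.add_sub_cancel' hij]; exact hv1
  refine ⟨s₀ / 2 ^ j, by positivity, div_le_self hs₀.le (one_le_pow₀ one_le_two), hj1, hj2, ?_⟩
  by_cases hgood : ∃ i, i < j ∧ ν.real (closedBall x (2 ^ q * (s₀ / 2 ^ i)))
      ≤ 2 ^ (q * (d + 1)) * ν.real (closedBall x (s₀ / 2 ^ i))
  · obtain ⟨i₀, hi₀j, hi₀⟩ := hgood
    set i := Nat.findGreatest (fun i => ν.real (closedBall x (2 ^ q * (s₀ / 2 ^ i)))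
      ≤ 2 ^ (q * (d + 1)) * ν.real (closedBall x (s₀ / 2 ^ i))) (j - 1) with hi
    have hi1 : i ≤ j - 1 := Nat.findGreatest_le _
    have hi2 := Nat.findGreatest_spec (P := fun i => ν.real (closedBall x (2 ^ q * (s₀ / 2 ^ i)))
      ≤ 2 ^ (q * (d + 1)) * ν.real (closedBall x (s₀ / 2 ^ i))) (n := j - 1)
      (show i₀ ≤ j - 1 by omega) hi₀
    rw [← hi] at hi2
    have h1 := hmin i (by omega) hi2
    have hle : s₀ / 2 ^ j ≤ s₀ / 2 ^ i := by
      gcongr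
      · exact one_le_two
      · omega
    have h2 := hcmp x hx x hx (s₀ / 2 ^ j) (s₀ / 2 ^ i) (by positivity) hle
      (by rw [dist_self]; positivity) (hdecay i (by omega) fun k hk1 hk2 =>
        Nat.findGreatest_is_greatest (by rw [← hi]; exact hk1) (by omega))
    have h3 := abs_sub_le (a x (s₀ / 2 ^ j)) (a x (s₀ / 2 ^ i)) (a x₀ s₀)
    linarith
  · push Not at hgood
    have h2 := hcmp x hx x₀ hx₀ (s₀ / 2 ^ j) s₀ (by positivity)
      (div_le_self hs₀.le (one_le_pow₀ one_le_two)) hd (by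
        simpa using hdecay 0 (by omega) fun k _ hk2 => not_le.2 (hgood k hk2))
    linarith

/-- Almost everywhere, `f` is within a bounded distance of `a x r` for some small doubling radius. -/
theorem ae_exists_doubling_abs_sub_le (hf : LocallyIntegrable f ν) (hM : 0 < M) (hΛ : Λ ≤ 2 ^ q)
    (hosc : ∀ x ∈ posBallSet ν, ∀ s, 0 < s →
      ∫⁻ y in closedBall x s, ‖f y - a x s‖ₑ ∂ν ≤ ENNReal.ofReal M * ν (closedBall x (Λ * s))) :
    ∀ᵐ x ∂ν, ∀ s, 0 < s → ∃ j : ℕ, ν.real (closedBall x (2 ^ q * (s / 2 ^ j)))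
      ≤ 2 ^ (q * (d + 1)) * ν.real (closedBall x (s / 2 ^ j)) ∧
        |f x - a x (s / 2 ^ j)| ≤ M * (2 ^ (q * (d + 1)) + 1) := by
  filter_upwards [ae_mem_posBallSet ν, ae_exists_doubling ν q,
    (Besicovitch.vitaliFamily ν).ae_tendsto_lintegral_enorm_sub_div hf] with x hx hgood hleb s hs
  have hto : Tendsto (fun i : ℕ => closedBall x (s / 2 ^ i)) atTop
      ((Besicovitch.vitaliFamily ν).filterAt x) := by
    refine (Besicovitch.tendsto_filterAt ν x).comp ?_
    refine tendsto_nhdsWithin_iff.2 ⟨?_, Eventually.of_forall fun i => by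
      rw [mem_Ioi]; positivity⟩
    have := (tendsto_pow_atTop_nhds_zero_of_lt_one (r := (1 / 2 : ℝ)) (by norm_num)
      (by norm_num)).const_mul s
    rw [mul_zero] at this
    refine this.congr fun i => ?_
    rw [one_div, inv_pow, ← div_eq_mul_inv]
  obtain ⟨J, hJ⟩ := eventually_atTop.1 ((hleb.comp hto).eventually_lt_const
    (ENNReal.ofReal_pos.2 hM))
  obtain ⟨j, hj1, hj2⟩ := hgood s hs J
  refine ⟨j, hj2, ?_⟩
  set r := s / 2 ^ j with hr
  have hr0 : 0 < r := by positivity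
  have hν0 := hx r hr0
  have hνt : ν (closedBall x r) ≠ ∞ := measure_closedBall_lt_top.ne
  have h1 := hJ j hj1
  simp only [Function.comp_apply] at h1
  have h2 := ((ENNReal.div_lt_iff (Or.inl hν0.ne') (Or.inl hνt)).1 h1).le
  have h3 := hosc x hx r hr0
  have h4 : ν (closedBall x (Λ * r)) ≤ ENNReal.ofReal (2 ^ (q * (d + 1))) * ν (closedBall x r) :=
    (measure_mono (closedBall_subset_closedBall (by gcongr))).trans
      (measure_le_ofReal_mul_of_real_le measure_closedBall_lt_top.ne hνt hj2 (by positivity))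
  have h5 : ‖f x - a x r‖ₑ * ν (closedBall x r)
      ≤ ENNReal.ofReal (M * (2 ^ (q * (d + 1)) + 1)) * ν (closedBall x r) := by
    calc ‖f x - a x r‖ₑ * ν (closedBall x r)
        ≤ _ := enorm_sub_mul_measure_le hf.aestronglyMeasurable _ _ _
      _ ≤ ENNReal.ofReal M * ν (closedBall x r) + ENNReal.ofReal M *
          (ENNReal.ofReal (2 ^ (q * (d + 1))) * ν (closedBall x r)) := by
        refine add_le_add h2 (h3.trans ?_)
        gcongr
      _ = _ := by
        rw [ENNReal.ofReal_mul hM.le, ENNReal.ofReal_add (by positivity) zero_le_one,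
          ENNReal.ofReal_one]
        ring
  have h6 := (ENNReal.mul_le_mul_iff_left hν0.ne' hνt).1 h5
  rw [Real.enorm_eq_ofReal_abs] at h6
  exact (ENNReal.ofReal_le_ofReal_iff (by positivity)).1 h6

/-- One step of the John–Nirenberg iteration. -/
theorem two_mul_measure_le_of_forall (hnd : n ≤ d) (hα : α ≤ 1) (hC : 0 < C)
    (hM : 0 < M) (hA : 0 < A) (hΛ1 : 1 ≤ Λ) (hΛ : 10 * Λ ≤ 2 ^ q) (hf : LocallyIntegrable f ν)
    (hgr : ∀ x ∈ posBallSet ν, ∀ r, 0 < r → ν.real (closedBall x r) ≤ C * r ^ n)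
    (hosc : ∀ x ∈ posBallSet ν, ∀ s, 0 < s →
      ∫⁻ y in closedBall x s, ‖f y - a x s‖ₑ ∂ν ≤ ENNReal.ofReal M * ν (closedBall x (Λ * s)))
    (hcmp : ∀ x ∈ posBallSet ν, ∀ y ∈ posBallSet ν, ∀ s t, 0 < s → s ≤ t → dist x y ≤ t →
      (∀ v, s ≤ v → v ≤ t → ν.real (closedBall x v)
        ≤ C * 2 ^ (q * (d + 1)) * 4 ^ (n + 1) * v ^ n * (v / t) ^ α) →
      |a x s - a y t| ≤ A * M)
    {c : ℝ≥0∞} {u : ℝ} (hu : 0 ≤ u)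
    (hc : ∀ x ∈ posBallSet ν, ∀ s, 0 < s →
      c * ν {y ∈ closedBall x s | u < |f y - a x s|} ≤ ν (closedBall x (2 * Λ * s)))
    {x₀ : Fin d → ℝ} (hx₀ : x₀ ∈ posBallSet ν) {s₀ : ℝ} (hs₀ : 0 < s₀) :
    2 * c * ν {y ∈ closedBall x₀ s₀ |
        u + M * (4 * 2 ^ (q * (d + 1)) * (1 + A) + 1) < |f y - a x₀ s₀|}
      ≤ ν (closedBall x₀ (2 * Λ * s₀)) := by
  set b : ℝ := 2 ^ (q * (d + 1)) with hb
  have hb1 : 1 ≤ b := one_le_pow₀ one_le_two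
  have hb0 : 0 < b := by positivity
  set B : ℝ := M * b + 2 * b * (1 + A) * M with hB
  have hB0 : 0 < B := by positivity
  -- comparison of values of `a` at comparable scales
  have hscale : ∀ x ∈ posBallSet ν, ∀ s t, 0 < s → s ≤ t → t ≤ 5 * s →
      |a x s - a x t| ≤ A * M := by
    intro x hx s t hs hst hts
    have ht : 0 < t := hs.trans_le hst
    refine hcmp x hx x hx s t hs hst (by rw [dist_self]; exact ht.le) fun v hv hvt => ?_
    have hv0 : 0 < v := hs.trans_le hv
    have h1 : (1 / 5 : ℝ) ≤ (v / t) ^ α := by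
      have h2 : (1 / 5 : ℝ) ≤ v / t := by rw [div_le_div_iff₀ (by norm_num) ht]; linarith
      refine h2.trans ?_
      simpa using Real.rpow_le_rpow_of_exponent_ge (by positivity : 0 < v / t)
        (by rw [div_le_one ht]; exact hvt) hα
    have h3 : (4 : ℝ) ≤ 4 ^ (n + 1) := by
      simpa using pow_le_pow_right₀ (show (1 : ℝ) ≤ 4 by norm_num) (show 1 ≤ n + 1 by omega)
    have hq10 : (10 : ℝ) ≤ b := by
      have h5 : (10 : ℝ) ≤ 2 ^ q := by linarith
      refine h5.trans (pow_le_pow_right₀ one_le_two ?_)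
      exact Nat.le_mul_of_pos_right q (by omega)
    have h4 : (5 : ℝ) ≤ b * 4 ^ (n + 1) := by nlinarith
    calc ν.real (closedBall x v) ≤ C * v ^ n := hgr x hx v hv0
      _ = C * 5 * v ^ n * (1 / 5) := by ring
      _ ≤ C * (b * 4 ^ (n + 1)) * v ^ n * (v / t) ^ α := by gcongr
      _ = _ := by ring
  -- stopping balls
  set T : Set (Fin d → ℝ) := {x | x ∈ posBallSet ν ∧ x ∈ closedBall x₀ s₀ ∧
    ∃ r, 0 < r ∧ r ≤ s₀ ∧ ν.real (closedBall x (2 ^ q * r)) ≤ b * ν.real (closedBall x r) ∧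
      B < |a x r - a x₀ s₀| ∧ |a x r - a x₀ s₀| ≤ B + A * M} with hT
  have hTae : ∀ᵐ x ∂ν, x ∈ closedBall x₀ s₀ → B + M * (b + 1) < |f x - a x₀ s₀| → x ∈ T := by
    filter_upwards [ae_mem_posBallSet ν, ae_exists_doubling_abs_sub_le (q := q) hf hM
      (by linarith) hosc] with x hx hx2 hxb hxf
    obtain ⟨j, hj1, hj2⟩ := hx2 s₀ hs₀
    refine ⟨hx, hxb, exists_stopping_radius hnd hα hC hgr hcmp hx hx₀ hs₀ hxb
      ⟨j, hj1, ?_⟩ hB0.le⟩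
    have := abs_sub_le (f x) (a x (s₀ / 2 ^ j)) (a x₀ s₀)
    linarith
  have hr' : ∀ x, ∃ r, x ∈ T → 0 < r ∧ r ≤ s₀ ∧
      ν.real (closedBall x (2 ^ q * r)) ≤ b * ν.real (closedBall x r) ∧
      B < |a x r - a x₀ s₀| ∧ |a x r - a x₀ s₀| ≤ B + A * M := by
    intro x
    by_cases hx : x ∈ T
    · obtain ⟨r, h⟩ := hx.2.2
      exact ⟨r, fun _ => h⟩
    · exact ⟨0, fun h => absurd h hx⟩
  choose r hr using hr'
  obtain ⟨U, hUT, hUdisj, hUcov⟩ := Vitali.exists_disjoint_subfamily_covering_enlargement_closedBall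
    T id r s₀ (fun x hx => (hr x hx).2.1) 5 (by norm_num)
  simp only [id] at hUdisj hUcov
  have hUc : U.Countable := hUdisj.countable_of_nonempty_interior fun x hx =>
    ⟨x, ball_subset_interior_closedBall (mem_ball_self (hr x (hUT hx)).1)⟩
  have hgoodU : ∀ y ∈ U, ∀ R, R ≤ 2 ^ q →
      ν (closedBall y (R * r y)) ≤ ENNReal.ofReal b * ν (closedBall y (r y)) := by
    intro y hy R hR
    obtain ⟨h1, -, h2, -⟩ := hr y (hUT hy)
    exact (measure_mono (closedBall_subset_closedBall (by gcongr))).trans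
      (measure_le_ofReal_mul_of_real_le measure_closedBall_lt_top.ne
        measure_closedBall_lt_top.ne h2 hb0.le)
  -- the stopping balls have small total measure
  have hsmall : ∀ y ∈ U, ENNReal.ofReal (2 * b * (1 + A) * M) * ν (closedBall y (r y))
      ≤ ∫⁻ z in closedBall y (r y), ‖f z - a x₀ s₀‖ₑ ∂ν := by
    intro y hy
    obtain ⟨h1, -, -, h3, -⟩ := hr y (hUT hy)
    have h4 : ENNReal.ofReal B ≤ ‖a y (r y) - a x₀ s₀‖ₑ := by
      rw [Real.enorm_eq_ofReal_abs]; exact ENNReal.ofReal_le_ofReal h3.le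
    have h5 : ENNReal.ofReal B * ν (closedBall y (r y))
        ≤ ENNReal.ofReal (M * b) * ν (closedBall y (r y)) +
          ∫⁻ z in closedBall y (r y), ‖f z - a x₀ s₀‖ₑ ∂ν := by
      calc _ ≤ ‖a y (r y) - a x₀ s₀‖ₑ * ν (closedBall y (r y)) := by gcongr
        _ ≤ _ := enorm_sub_mul_measure_le hf.aestronglyMeasurable _ _ _
        _ ≤ _ := by
          gcongr
          refine (hosc y (hUT hy).1 _ h1).trans ?_
          rw [ENNReal.ofReal_mul hM.le, mul_assoc]
          gcongr
          exact hgoodU y hy Λ (by linarith)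
    rw [hB, ENNReal.ofReal_add (by positivity) (by positivity), add_mul] at h5
    exact (ENNReal.add_le_add_iff_left (ENNReal.mul_ne_top ENNReal.ofReal_ne_top
      measure_closedBall_lt_top.ne)).1 h5
  have hsum : ENNReal.ofReal (2 * b) * ∑' y : U, ν (closedBall (y : Fin d → ℝ) (r y))
      ≤ ν (closedBall x₀ (2 * Λ * s₀)) := by
    have h1 : ENNReal.ofReal (2 * b * (1 + A) * M) *
        ∑' y : U, ν (closedBall (y : Fin d → ℝ) (r y))
        ≤ ENNReal.ofReal ((1 + A) * M) * ν (closedBall x₀ (2 * Λ * s₀)) := by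
      rw [← ENNReal.tsum_mul_left]
      calc ∑' y : U, ENNReal.ofReal (2 * b * (1 + A) * M) * ν (closedBall (y : Fin d → ℝ) (r y))
          ≤ ∑' y : U, ∫⁻ z in closedBall (y : Fin d → ℝ) (r y), ‖f z - a x₀ s₀‖ₑ ∂ν :=
            ENNReal.tsum_le_tsum fun y => hsmall y y.2
        _ = ∫⁻ z in ⋃ y ∈ U, closedBall y (r y), ‖f z - a x₀ s₀‖ₑ ∂ν :=
            (lintegral_biUnion hUc (fun _ _ => measurableSet_closedBall) hUdisj _).symm
        _ ≤ ∫⁻ z in closedBall x₀ (2 * s₀), ‖f z - a x₀ s₀‖ₑ ∂ν := by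
            refine lintegral_mono_set (iUnion₂_subset fun y hy => ?_)
            refine closedBall_subset_closedBall' ?_
            have h2 := (hr y (hUT hy)).2.1
            have h3 : dist y x₀ ≤ s₀ := (hUT hy).2.1
            linarith
        _ ≤ _ := lintegral_enorm_sub_le f _ (a x₀ (2 * s₀)) _
        _ ≤ ENNReal.ofReal M * ν (closedBall x₀ (2 * Λ * s₀)) +
            ENNReal.ofReal (A * M) * ν (closedBall x₀ (2 * Λ * s₀)) := by
            gcongr
            · refine (hosc x₀ hx₀ (2 * s₀) (by positivity)).trans (le_of_eq ?_)
              congr 3; ring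
            · rw [Real.enorm_eq_ofReal_abs, abs_sub_comm]
              exact ENNReal.ofReal_le_ofReal
                (hscale x₀ hx₀ s₀ (2 * s₀) hs₀ (by linarith) (by linarith))
            · nlinarith
        _ = _ := by
            rw [← add_mul, ← ENNReal.ofReal_add hM.le (by positivity)]
            congr 2; ring
    rw [show 2 * b * (1 + A) * M = (1 + A) * M * (2 * b) by ring,
      ENNReal.ofReal_mul (by positivity), mul_assoc] at h1
    exact (ENNReal.mul_le_mul_iff_right (ENNReal.ofReal_pos.2 (by positivity)).ne'
      ENNReal.ofReal_ne_top).1 h1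
  -- covering of the exceptional set
  set E := {y ∈ closedBall x₀ s₀ | u + M * (4 * b * (1 + A) + 1) < |f y - a x₀ s₀|} with hE
  have hcov : ν E ≤ ∑' y : U, ν {z ∈ closedBall (y : Fin d → ℝ) (5 * r y) |
      u < |f z - a y (5 * r y)|} := by
    refine le_trans (measure_mono_ae ?_) (measure_biUnion_le ν hUc fun y =>
      {z ∈ closedBall y (5 * r y) | u < |f z - a y (5 * r y)|})
    filter_upwards [hTae] with x hxT hxE
    obtain ⟨hxb, hxf⟩ := hxE
    have hbA : 0 < b * A * M := by positivity
    have hbM : 0 < b * M := by positivity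
    have hAM : A * M ≤ b * A * M := by
      rw [mul_assoc]; exact le_mul_of_one_le_left (by positivity) hb1
    have hxT' : x ∈ T := hxT hxb (by rw [hB]; nlinarith)
    obtain ⟨y, hy, hxy⟩ := hUcov x hxT'
    refine mem_iUnion₂.2 ⟨y, hy, hxy (mem_closedBall_self (hr x hxT').1.le), ?_⟩
    obtain ⟨h1, -, -, -, h2⟩ := hr y (hUT hy)
    have h3 := hscale y (hUT hy).1 (r y) (5 * r y) h1 (by linarith) le_rfl
    have h4 := abs_sub_le (f x) (a y (5 * r y)) (a x₀ s₀)
    have h5 := abs_sub_le (a y (5 * r y)) (a y (r y)) (a x₀ s₀)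
    rw [abs_sub_comm (a y (5 * r y)) (a y (r y))] at h5
    change u < _
    rw [hB] at h2
    nlinarith
  calc 2 * c * ν E ≤ 2 * c * ∑' y : U, ν {z ∈ closedBall (y : Fin d → ℝ) (5 * r y) |
        u < |f z - a y (5 * r y)|} := by gcongr
    _ = 2 * ∑' y : U, c * ν {z ∈ closedBall (y : Fin d → ℝ) (5 * r y) |
        u < |f z - a y (5 * r y)|} := by rw [mul_assoc, ENNReal.tsum_mul_left]
    _ ≤ 2 * ∑' y : U, ENNReal.ofReal b * ν (closedBall (y : Fin d → ℝ) (r y)) := by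
      refine mul_le_mul' le_rfl (ENNReal.tsum_le_tsum fun y => ?_)
      refine (hc y (hUT y.2).1 (5 * r y) (by linarith [(hr y (hUT y.2)).1])).trans ?_
      rw [show 2 * Λ * (5 * r y) = 10 * Λ * r y by ring]
      exact hgoodU y y.2 _ hΛ
    _ = ENNReal.ofReal (2 * b) * ∑' y : U, ν (closedBall (y : Fin d → ℝ) (r y)) := by
      rw [ENNReal.tsum_mul_left, ENNReal.ofReal_mul zero_le_two, mul_assoc]
      simp
    _ ≤ _ := hsum

/-- John–Nirenberg inequality: exponential decay of the distribution function. -/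
theorem two_pow_mul_measure_le (hnd : n ≤ d) (hα : α ≤ 1) (hC : 0 < C)
    (hM : 0 < M) (hA : 0 < A) (hΛ1 : 1 ≤ Λ) (hΛ : 10 * Λ ≤ 2 ^ q) (hf : LocallyIntegrable f ν)
    (hgr : ∀ x ∈ posBallSet ν, ∀ r, 0 < r → ν.real (closedBall x r) ≤ C * r ^ n)
    (hosc : ∀ x ∈ posBallSet ν, ∀ s, 0 < s →
      ∫⁻ y in closedBall x s, ‖f y - a x s‖ₑ ∂ν ≤ ENNReal.ofReal M * ν (closedBall x (Λ * s)))
    (hcmp : ∀ x ∈ posBallSet ν, ∀ y ∈ posBallSet ν, ∀ s t, 0 < s → s ≤ t → dist x y ≤ t →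
      (∀ v, s ≤ v → v ≤ t → ν.real (closedBall x v)
        ≤ C * 2 ^ (q * (d + 1)) * 4 ^ (n + 1) * v ^ n * (v / t) ^ α) →
      |a x s - a y t| ≤ A * M) (k : ℕ) :
    ∀ x ∈ posBallSet ν, ∀ s, 0 < s →
      2 ^ k * ν {y ∈ closedBall x s |
        k * (M * (4 * 2 ^ (q * (d + 1)) * (1 + A) + 1)) < |f y - a x s|}
      ≤ ν (closedBall x (2 * Λ * s)) := by
  induction k with
  | zero =>
    intro x _ s hs
    rw [pow_zero, one_mul]
    refine (measure_mono (sep_subset _ _)).trans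
      (measure_mono (closedBall_subset_closedBall ?_))
    nlinarith
  | succ k ih =>
    intro x hx s hs
    have := two_mul_measure_le_of_forall hnd hα hC hM hA hΛ1 hΛ hf hgr hosc hcmp
      (c := 2 ^ k) (u := k * (M * (4 * 2 ^ (q * (d + 1)) * (1 + A) + 1))) (by positivity) ih hx hs
    rw [pow_succ', Nat.cast_succ, add_one_mul]
    exact this

end JohnNirenberg

/-! ### Cubes of Euclidean space as balls of the supremum norm -/

section Transfer

variable {d n : ℕ}

/-- Euclidean space is homeomorphic to `Fin d → ℝ` with the supremum norm. -/
def eucHomeo (d : ℕ) : Euc d ≃ₜ (Fin d → ℝ) := (EuclideanSpace.equiv (Fin d) ℝ).toHomeomorph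

/-- A measure on Euclidean space, viewed on `Fin d → ℝ`. -/
def supMeasure (μ : Measure (Euc d)) : Measure (Fin d → ℝ) := μ.map (eucHomeo d)

/-- The cube which is the closed ball of radius `r` of the supremum norm. -/
def ballCube (x : Fin d → ℝ) (r : ℝ) : Cube d := ⟨(eucHomeo d).symm x, 2 * r⟩

/-- The mean value of `F` on a closed ball. -/
def ballAvg (ν : Measure (Fin d → ℝ)) (F : (Fin d → ℝ) → ℝ) (x : Fin d → ℝ) (r : ℝ) : ℝ :=
  (ν.real (closedBall x r))⁻¹ * ∫ y in closedBall x r, F y ∂ν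

theorem ballCube_set (x : Fin d → ℝ) {r : ℝ} (hr : 0 ≤ r) :
    (ballCube x r).set = eucHomeo d ⁻¹' closedBall x r := by
  ext y
  simp only [Cube.set, ballCube, mem_ofPred_eq, mem_preimage, mem_closedBall,
    dist_pi_le_iff hr, Real.dist_eq]
  refine forall_congr' fun i => ?_
  rw [mul_div_cancel_left₀ r two_ne_zero]
  rfl

theorem ballCube_dilate (x : Fin d → ℝ) (r c : ℝ) :
    (ballCube x r).dilate c = ballCube x (c * r) := by
  simp only [ballCube, Cube.dilate, mul_left_comm]

variable {μ : Measure (Euc d)}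

theorem isLocallyFiniteMeasure_supMeasure [IsLocallyFiniteMeasure μ] :
    IsLocallyFiniteMeasure (supMeasure μ) := by
  refine ⟨fun x => ?_⟩
  obtain ⟨s, hs, hμ⟩ := μ.finiteAt_nhds ((eucHomeo d).symm x)
  refine ⟨(eucHomeo d).symm ⁻¹' s, (eucHomeo d).symm.continuous.continuousAt hs, ?_⟩
  rwa [supMeasure, (eucHomeo d).measurableEmbedding.map_apply, ← preimage_comp,
    Homeomorph.symm_comp_self, preimage_id]

theorem supMeasure_closedBall (x : Fin d → ℝ) {r : ℝ} (hr : 0 ≤ r) :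
    supMeasure μ (closedBall x r) = μ (ballCube x r).set := by
  rw [supMeasure, (eucHomeo d).measurableEmbedding.map_apply, ballCube_set x hr]

theorem supMeasure_real_closedBall (x : Fin d → ℝ) {r : ℝ} (hr : 0 ≤ r) :
    (supMeasure μ).real (closedBall x r) = (μ (ballCube x r).set).toReal := by
  rw [Measure.real, supMeasure_closedBall x hr]

theorem setIntegral_supMeasure_closedBall (G : Euc d → ℝ) (x : Fin d → ℝ) {r : ℝ} (hr : 0 ≤ r) :
    ∫ y in closedBall x r, G ((eucHomeo d).symm y) ∂supMeasure μ
      = ∫ z in (ballCube x r).set, G z ∂μ := by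
  rw [supMeasure, (eucHomeo d).measurableEmbedding.setIntegral_map, ballCube_set x hr]
  simp

theorem cubeAvg_ballCube (f : Euc d → ℝ) (x : Fin d → ℝ) {r : ℝ} (hr : 0 ≤ r) :
    cubeAvg μ (ballCube x r) f = ballAvg (supMeasure μ) (f ∘ (eucHomeo d).symm) x r := by
  rw [cubeAvg, ballAvg, supMeasure_real_closedBall x hr, ← setIntegral_supMeasure_closedBall f x hr]
  rfl

theorem isCube_ballCube {x : Fin d → ℝ} {r : ℝ} (hr : 0 < r) (hx : x ∈ posBallSet (supMeasure μ)) :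
    IsCube μ (ballCube x r) := by
  refine ⟨by simpa [ballCube] using hr, fun s hs => ?_⟩
  obtain ⟨t, ht, hts⟩ := nhds_basis_closedBall.mem_iff.1
    ((eucHomeo d).symm.continuous.continuousAt (x := x) (ball_mem_nhds _ hs))
  refine (hx t ht).trans_le ?_
  rw [supMeasure, (eucHomeo d).measurableEmbedding.map_apply]
  refine measure_mono fun y hy => ?_
  simpa [ballCube] using hts hy

theorem IsCube.mem_posBallSet {Q : Cube d} (hQ : IsCube μ Q) :
    eucHomeo d Q.center ∈ posBallSet (supMeasure μ) := by
  intro r hr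
  obtain ⟨t, ht, hts⟩ := nhds_basis_ball.mem_iff.1
    ((eucHomeo d).continuous.continuousAt (x := Q.center) (closedBall_mem_nhds _ hr))
  refine (hQ.2 t ht).trans_le ?_
  rw [supMeasure, (eucHomeo d).measurableEmbedding.map_apply]
  exact measure_mono hts

theorem isDoubling_ballCube_iff [IsLocallyFiniteMeasure μ] {ρ β : ℝ} (hρ : 0 ≤ ρ) (hβ : 0 ≤ β)
    (x : Fin d → ℝ) {r : ℝ} (hr : 0 ≤ r) :
    IsDoubling μ ρ β (ballCube x r) ↔ (supMeasure μ).real (closedBall x (ρ * r))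
      ≤ β * (supMeasure μ).real (closedBall x r) := by
  have := isLocallyFiniteMeasure_supMeasure (μ := μ)
  rw [IsDoubling, ballCube_dilate, ← supMeasure_closedBall x (by positivity),
    ← supMeasure_closedBall x hr, Measure.real, Measure.real]
  have h1 : supMeasure μ (closedBall x (ρ * r)) ≠ ∞ := measure_closedBall_lt_top.ne
  have h2 : supMeasure μ (closedBall x r) ≠ ∞ := measure_closedBall_lt_top.ne
  rw [← ENNReal.toReal_le_toReal h1 (ENNReal.mul_ne_top ENNReal.ofReal_ne_top h2),
    ENNReal.toReal_mul, ENNReal.toReal_ofReal hβ]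

theorem tilde_ballCube [IsLocallyFiniteMeasure μ] {ρ β : ℝ} (hρ : 0 ≤ ρ) (hβ : 0 ≤ β)
    (x : Fin d → ℝ) {t : ℝ} (ht : 0 ≤ t) {k : ℕ}
    (hk : (supMeasure μ).real (closedBall x (ρ * (2 ^ k * t)))
      ≤ β * (supMeasure μ).real (closedBall x (2 ^ k * t)))
    (hlt : ∀ i < k, ¬ (supMeasure μ).real (closedBall x (ρ * (2 ^ i * t)))
      ≤ β * (supMeasure μ).real (closedBall x (2 ^ i * t))) :
    tilde μ ρ β (ballCube x t) = ballCube x (2 ^ k * t) := by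
  have : sInf {N : ℕ | IsDoubling μ ρ β ((ballCube x t).dilate (2 ^ N))} = k := by
    simp only [ballCube_dilate]
    refine le_antisymm (Nat.sInf_le ((isDoubling_ballCube_iff hρ hβ x (by positivity)).2 hk)) ?_
    refine le_csInf ⟨k, (isDoubling_ballCube_iff hρ hβ x (by positivity)).2 hk⟩ fun i hi => ?_
    by_contra hik
    exact hlt i (not_le.1 hik) ((isDoubling_ballCube_iff hρ hβ x (by positivity)).1 hi)
  rw [tilde, this, ballCube_dilate]

theorem SQR_ballCube_le (x y : Fin d → ℝ) {p r : ℝ} (hp : 0 < p) :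
    SQR μ n (ballCube x p) (ballCube y r)
      ≤ 1 + chainSum (fun s => (supMeasure μ).real (closedBall x s)) n p r := by
  have hN : NQR (ballCube x p) (ballCube y r) = chainLength p r := by
    rw [NQR, chainLength]
    congr 1
    ext k
    simp only [ballCube, mem_ofPred_eq, mul_left_comm _ (2 : ℝ),
      mul_le_mul_iff_of_pos_left (zero_lt_two (α := ℝ))]
  rw [SQR, chainSum, hN]
  gcongr with k hk
  · rw [ballCube_dilate, supMeasure_real_closedBall x (by positivity)]
  · simp only [ballCube]; linarith

end Transfer

/-! ### Mean values of functions in `rbmo` -/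

section MeanValues

variable {d n : ℕ} {ν : Measure (Fin d → ℝ)} [IsLocallyFiniteMeasure ν] {F : (Fin d → ℝ) → ℝ}

theorem lintegral_enorm_sub_le_of_integral_le (hF : LocallyIntegrable F ν) {x : Fin d → ℝ}
    {s t u M b : ℝ} (hM : 0 ≤ M) (hst : s ≤ t)
    (h : ∫ y in closedBall x t, |F y - b| ∂ν ≤ M * ν.real (closedBall x u)) :
    ∫⁻ y in closedBall x s, ‖F y - b‖ₑ ∂ν ≤ ENNReal.ofReal M * ν (closedBall x u) := by
  have hintegrable : IntegrableOn (fun y => F y - b) (closedBall x t) ν :=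
    (hF.integrableOn_isCompact (isCompact_closedBall x t)).sub
      (integrableOn_const measure_closedBall_lt_top.ne)
  refine (lintegral_mono_set (closedBall_subset_closedBall hst)).trans ?_
  rw [← ofReal_integral_norm_eq_lintegral_enorm hintegrable,
    ← ofReal_measureReal (measure_closedBall_lt_top.ne), ← ENNReal.ofReal_mul hM]
  exact ENNReal.ofReal_le_ofReal h

theorem abs_ballAvg_le {x : Fin d → ℝ} {r η ρ β C : ℝ} (hν : 0 < ν.real (closedBall x r))
    (hr : 0 ≤ r) (hC : 0 ≤ C) (hηρ : η ≤ ρ)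
    (hd : ν.real (closedBall x (ρ * r)) ≤ β * ν.real (closedBall x r))
    (h : ∫ y in closedBall x r, |F y| ∂ν ≤ C * ν.real (closedBall x (η * r))) :
    |ballAvg ν F x r| ≤ C * β := by
  have h1 : ν.real (closedBall x (η * r)) ≤ ν.real (closedBall x (ρ * r)) :=
    measureReal_mono (closedBall_subset_closedBall (by gcongr)) measure_closedBall_lt_top.ne
  rw [ballAvg, abs_mul, abs_inv, abs_of_pos hν, inv_mul_le_iff₀ hν]
  calc |∫ y in closedBall x r, F y ∂ν| ≤ _ := abs_integral_le_integral_abs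
    _ ≤ C * ν.real (closedBall x (η * r)) := h
    _ ≤ C * (β * ν.real (closedBall x r)) := by gcongr; exact h1.trans hd
    _ = _ := by ring

theorem integral_abs_sub_le (hF : LocallyIntegrable F ν) {x : Fin d → ℝ} {t η C c b : ℝ}
    (ht : 0 ≤ t) (hη : 1 ≤ η) (hb : |b| ≤ c)
    (h : ∫ y in closedBall x t, |F y| ∂ν ≤ C * ν.real (closedBall x (η * t))) :
    ∫ y in closedBall x t, |F y - b| ∂ν ≤ (C + c) * ν.real (closedBall x (η * t)) := by
  have hintegrable : IntegrableOn F (closedBall x t) ν :=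
    hF.integrableOn_isCompact (isCompact_closedBall x t)
  have hconst : ∀ c : ℝ, IntegrableOn (fun _ => c) (closedBall x t) ν := fun c =>
    integrableOn_const measure_closedBall_lt_top.ne
  have hc : 0 ≤ c := (abs_nonneg b).trans hb
  calc ∫ y in closedBall x t, |F y - b| ∂ν ≤ ∫ y in closedBall x t, (|F y| + c) ∂ν := by
        refine integral_mono (hintegrable.sub (hconst b)).abs
          (hintegrable.abs.add (hconst c)) fun y => ?_
        exact (abs_sub _ _).trans (by gcongr)
    _ = ∫ y in closedBall x t, |F y| ∂ν + c * ν.real (closedBall x t) := by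
        rw [integral_add hintegrable.abs (hconst c), setIntegral_const, smul_eq_mul, mul_comm c]
    _ ≤ C * ν.real (closedBall x (η * t)) + c * ν.real (closedBall x (η * t)) := by
        gcongr
        · exact measure_closedBall_lt_top.ne
        · nlinarith
    _ = _ := by ring

end MeanValues

theorem chainSum_nonneg {m : ℝ → ℝ} (hm : ∀ r, 0 ≤ m r) (n : ℕ) {p : ℝ} (hp : 0 < p) (r : ℝ) :
    0 ≤ chainSum m n p r :=
  Finset.sum_nonneg fun _ _ => div_nonneg (hm _) (by positivity)

/-- Oscillation estimates, at all scales, for a function with a given `rbmo` bound. -/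
theorem RbmoLocBound.ball_estimates {d n : ℕ} {μ : Measure (Euc d)} [IsLocallyFiniteMeasure μ]
    {η ρ β C : ℝ} {f : Euc d → ℝ} (hη : 1 < η) (hηρ : η ≤ ρ) (hβ : 0 ≤ β) (hC : 0 ≤ C)
    (hf : LocallyIntegrable f μ) (h : RbmoLocBound μ n η ρ β f C)
    {ν : Measure (Fin d → ℝ)} (hν : ν = supMeasure μ) {F : (Fin d → ℝ) → ℝ}
    (hF : F = f ∘ (eucHomeo d).symm) :
    LocallyIntegrable F ν ∧
    (∀ x ∈ posBallSet ν, ∀ t k, 0 < t →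
      ν.real (closedBall x (ρ * (2 ^ k * t))) ≤ β * ν.real (closedBall x (2 ^ k * t)) →
      (∀ i < k, ¬ ν.real (closedBall x (ρ * (2 ^ i * t))) ≤ β * ν.real (closedBall x (2 ^ i * t))) →
      ∫ y in closedBall x t, |F y - ballAvg ν F x (2 ^ k * t)| ∂ν
        ≤ C * (1 + 2 * β) * ν.real (closedBall x (η * t))) ∧
    (∀ x ∈ posBallSet ν, ∀ y ∈ posBallSet ν, ∀ p r, 0 < p → dist x y + p ≤ r →
      ν.real (closedBall x (ρ * p)) ≤ β * ν.real (closedBall x p) →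
      ν.real (closedBall y (ρ * r)) ≤ β * ν.real (closedBall y r) →
      |ballAvg ν F x p - ballAvg ν F y r|
        ≤ C * (1 + 2 * β) * (1 + chainSum (fun s => ν.real (closedBall x s)) n p r)) ∧
    (∀ x ∈ posBallSet ν, ∀ r, 1 < 2 * r →
      ν.real (closedBall x (ρ * r)) ≤ β * ν.real (closedBall x r) →
      |ballAvg ν F x r| ≤ C * β) := by
  have hlf : IsLocallyFiniteMeasure ν := hν ▸ isLocallyFiniteMeasure_supMeasure
  have hFint : LocallyIntegrable F ν := by
    rw [hν, supMeasure, locallyIntegrable_map_homeomorph, hF]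
    simpa [Function.comp_assoc] using hf
  have hρ0 : 0 ≤ ρ := by linarith
  have hpos : ∀ x ∈ posBallSet ν, ∀ r, 0 < r → 0 < ν.real (closedBall x r) := fun x hx r hr =>
    ENNReal.toReal_pos (hx r hr).ne' measure_closedBall_lt_top.ne
  have hlarge : ∀ x ∈ posBallSet ν, ∀ r, 1 < 2 * r →
      ∫ y in closedBall x r, |F y| ∂ν ≤ C * ν.real (closedBall x (η * r)) := by
    intro x hx r hr
    have hr0 : 0 < r := by linarith
    subst hν hF
    have h3 := h.2.2 (ballCube x r) (isCube_ballCube hr0 hx) hr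
    rwa [ballCube_dilate, ← supMeasure_real_closedBall x (by positivity),
      ← setIntegral_supMeasure_closedBall (fun z => |f z|) x hr0.le] at h3
  have havg : ∀ x ∈ posBallSet ν, ∀ r, 1 < 2 * r →
      ν.real (closedBall x (ρ * r)) ≤ β * ν.real (closedBall x r) →
      |ballAvg ν F x r| ≤ C * β := fun x hx r hr hd =>
    abs_ballAvg_le (hpos x hx r (by linarith)) (by linarith) hC hηρ hd (hlarge x hx r hr)
  have hCβ : 0 ≤ C * β := by positivity
  refine ⟨hFint, fun x hx t k ht hk hlt => ?_, fun x hx y hy p r hp hpr hdp hdr => ?_, havg⟩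
  · rcases le_or_gt (2 * t) 1 with ht1 | ht1
    · have hsmall : ∫ y in closedBall x t, |F y - ballAvg ν F x (2 ^ k * t)| ∂ν
          ≤ C * ν.real (closedBall x (η * t)) := by
        subst hν hF
        have h1 := h.1 (ballCube x t) (isCube_ballCube ht hx) ht1
        rwa [tilde_ballCube hρ0 hβ x ht.le hk hlt, cubeAvg_ballCube f x (by positivity),
          ballCube_dilate, ← supMeasure_real_closedBall x (by positivity),
          ← setIntegral_supMeasure_closedBall (fun z => |f z - _|) x ht.le] at h1
      refine hsmall.trans ?_
      gcongr
      nlinarith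
    · have h1 : t ≤ 2 ^ k * t := le_mul_of_one_le_left ht.le (one_le_pow₀ one_le_two)
      refine (integral_abs_sub_le hFint ht.le hη.le (havg x hx _ (by linarith) hk)
        (hlarge x hx t ht1)).trans ?_
      gcongr
      nlinarith
  · have hS := chainSum_nonneg (fun s => measureReal_nonneg (μ := ν) (s := closedBall x s)) n hp r
    rcases le_or_gt (2 * p) 1 with hp1 | hp1
    · have hsmall : |ballAvg ν F x p - ballAvg ν F y r|
          ≤ C * (1 + chainSum (fun s => ν.real (closedBall x s)) n p r) := by
        have hr : 0 < r := by linarith [dist_nonneg (x := x) (y := y)]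
        subst hν hF
        have h2 := h.2.1 (ballCube x p) (ballCube y r) (isCube_ballCube hp hx)
          (isCube_ballCube hr hy) hp1 (by
            rw [ballCube_set x hp.le, ballCube_set y hr.le]
            exact preimage_mono (closedBall_subset_closedBall' (by linarith)))
          ((isDoubling_ballCube_iff hρ0 hβ x hp.le).2 hdp)
          ((isDoubling_ballCube_iff hρ0 hβ y hr.le).2 hdr)
        rw [cubeAvg_ballCube f x hp.le, cubeAvg_ballCube f y hr.le] at h2
        exact h2.trans (by gcongr; exact SQR_ballCube_le x y hp)
      refine hsmall.trans ?_
      gcongr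
      nlinarith
    · have h1 := havg x hx p hp1 hdp
      have h2 := havg y hy r (by linarith [dist_nonneg (x := x) (y := y)]) hdr
      have h3 := abs_sub (ballAvg ν F x p) (ballAvg ν F y r)
      have h4 : 0 ≤ C * (1 + 2 * β) * chainSum (fun s => ν.real (closedBall x s)) n p r := by
        positivity
      linarith

/-! ### Exponential integrability -/

theorem ofReal_exp_le_one_add_tsum (u : ℝ) :
    ENNReal.ofReal (Real.exp (Real.log (3 / 2) * u)) ≤ 1 + ∑' k : ℕ,
      {v : ℝ | k < v}.indicator (fun _ => ENNReal.ofReal ((3 / 2) ^ (k + 1))) u := by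
  have hl : 0 < Real.log (3 / 2) := Real.log_pos (by norm_num)
  rcases le_or_gt u 0 with hu | hu
  · refine le_add_right (ENNReal.ofReal_le_one.2 (Real.exp_le_one_iff.2 ?_))
    exact mul_nonpos_of_nonneg_of_nonpos hl.le hu
  · obtain ⟨k, hk⟩ : ∃ k, ⌈u⌉₊ = k + 1 := ⟨⌈u⌉₊ - 1, by have := Nat.ceil_pos.2 hu; omega⟩
    have h1 : (k : ℝ) < u := Nat.lt_ceil.1 (by omega)
    have h2 : u ≤ (k + 1 : ℕ) := hk ▸ Nat.le_ceil u
    refine le_add_left (le_trans ?_ (ENNReal.le_tsum k))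
    rw [indicator_of_mem (show u ∈ {v : ℝ | k < v} from h1)]
    refine ENNReal.ofReal_le_ofReal ?_
    rw [← Real.rpow_natCast, Real.rpow_def_of_pos (by norm_num)]
    gcongr

theorem lintegral_exp_le_of_two_pow_mul_measure_le {X : Type*} [MeasurableSpace X] {ν : Measure X}
    {s : Set X} (hs : MeasurableSet s) {g : X → ℝ} (hg : AEMeasurable g (ν.restrict s)) {c : ℝ}
    (hc : 0 < c) {V : ℝ≥0∞} (h : ∀ k : ℕ, 2 ^ k * ν {y ∈ s | k * c < g y} ≤ V) :
    ∫⁻ y in s, ENNReal.ofReal (Real.exp (Real.log (3 / 2) * (g y / c))) ∂ν ≤ ν s + 6 * V := by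
  have hnull : ∀ k : ℕ, NullMeasurableSet {y | (k : ℝ) < g y / c} (ν.restrict s) := fun k =>
    nullMeasurableSet_lt aemeasurable_const (hg.div_const c)
  have hset : ∀ k : ℕ, ν.restrict s {y | (k : ℝ) < g y / c} ≤ V * (2 ^ k)⁻¹ := by
    intro k
    rw [Measure.restrict_apply' hs, ← div_eq_mul_inv,
      ENNReal.le_div_iff_mul_le (by simp) (by simp), mul_comm]
    convert h k using 3
    ext y
    simp only [mem_inter_iff, mem_ofPred_eq, lt_div_iff₀ hc]
    exact and_comm
  calc ∫⁻ y in s, ENNReal.ofReal (Real.exp (Real.log (3 / 2) * (g y / c))) ∂ν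
      ≤ ∫⁻ y in s, (1 + ∑' k : ℕ, {y | (k : ℝ) < g y / c}.indicator
          (fun _ => ENNReal.ofReal ((3 / 2) ^ (k + 1))) y) ∂ν :=
        lintegral_mono fun y => ofReal_exp_le_one_add_tsum (g y / c)
    _ = ν s + ∑' k : ℕ, ENNReal.ofReal ((3 / 2) ^ (k + 1)) *
          ν.restrict s {y | (k : ℝ) < g y / c} := by
        rw [lintegral_add_left measurable_const, setLIntegral_const, one_mul,
          lintegral_tsum fun k => aemeasurable_const.indicator₀ (hnull k)]
        simp only [lintegral_indicator_const₀ (hnull _)]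
    _ ≤ ν s + ∑' k : ℕ, ENNReal.ofReal (3 / 2 * (3 / 4) ^ k) * V := by
        refine add_le_add le_rfl (ENNReal.tsum_le_tsum fun k => ?_)
        refine (mul_le_mul' le_rfl (hset k)).trans (le_of_eq ?_)
        have h2 : ((2 : ℝ≥0∞) ^ k)⁻¹ = ENNReal.ofReal ((1 / 2) ^ k) := by
          rw [ENNReal.ofReal_pow (by norm_num), one_div, ENNReal.ofReal_inv_of_pos two_pos,
            ENNReal.inv_pow]
          simp
        rw [h2, mul_comm V, ← mul_assoc, ← ENNReal.ofReal_mul (by positivity), pow_succ,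
          mul_comm _ (3 / 2 : ℝ), mul_assoc, ← mul_pow]
        norm_num
    _ = ν s + 6 * V := by
        rw [ENNReal.tsum_mul_right, ← ENNReal.ofReal_tsum_of_nonneg (fun k => by positivity)
          ((summable_geometric_of_lt_one (by norm_num) (by norm_num)).mul_left _), tsum_mul_left,
          tsum_geometric_of_lt_one (by norm_num) (by norm_num)]
        norm_num

theorem lintegral_exp_div_sub_one_le_one {X : Type*} [MeasurableSpace X] {ν : Measure X}
    {h : X → ℝ} {L : ℝ} (hL : 1 ≤ L)
    (hintegrable : ∫⁻ y, ENNReal.ofReal (Real.exp (h y)) ∂ν ≤ ENNReal.ofReal L) :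
    ∫⁻ y, ENNReal.ofReal (Real.exp (h y / L) - 1) ∂ν ≤ 1 := by
  have hL0 : 0 < L := by linarith
  have hpt : ∀ u : ℝ, Real.exp (u / L) - 1 ≤ L⁻¹ * Real.exp u := by
    intro u
    have h1 := convexOn_exp.2 (mem_univ u) (mem_univ 0) (inv_nonneg.2 hL0.le)
      (sub_nonneg.2 (inv_le_one_of_one_le₀ hL)) (by ring)
    simp only [smul_eq_mul, mul_zero, add_zero, Real.exp_zero, mul_one] at h1
    rw [inv_mul_eq_div] at h1
    have h2 : 0 ≤ L⁻¹ := inv_nonneg.2 hL0.le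
    linarith
  calc ∫⁻ y, ENNReal.ofReal (Real.exp (h y / L) - 1) ∂ν
      ≤ ∫⁻ y, ENNReal.ofReal L⁻¹ * ENNReal.ofReal (Real.exp (h y)) ∂ν :=
        lintegral_mono fun y => by
          rw [← ENNReal.ofReal_mul (inv_nonneg.2 hL0.le)]
          exact ENNReal.ofReal_le_ofReal (hpt _)
    _ = ENNReal.ofReal L⁻¹ * ∫⁻ y, ENNReal.ofReal (Real.exp (h y)) ∂ν :=
        lintegral_const_mul' _ _ ENNReal.ofReal_ne_top
    _ ≤ ENNReal.ofReal L⁻¹ * ENNReal.ofReal L := by gcongr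
    _ = 1 := by
        rw [← ENNReal.ofReal_mul (inv_nonneg.2 hL0.le), inv_mul_cancel₀ hL0.ne',
          ENNReal.ofReal_one]

/-- Functions with `rbmo` bound `C` are exponentially integrable on unit balls of the supremum
norm, with constants depending only on the measure and the parameters. -/
theorem exists_lintegral_exp_le_of_rbmoLocBound {d n : ℕ} (μ : Measure (Euc d))
    [IsLocallyFiniteMeasure μ] {C₀ η ρ β : ℝ} (hnd : n ≤ d) (hC₀ : 0 < C₀)
    (hgrowthQ : ∀ Q : Cube d, IsCube μ Q → μ Q.set ≤ ENNReal.ofReal (C₀ * Q.side ^ n))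
    (hη : 1 < η) (hηρ : η ≤ ρ) (hβ : ρ ^ n < β) :
    ∃ K L : ℝ, 0 < K ∧ 1 ≤ L ∧ ∀ (f : Euc d → ℝ) (C : ℝ), 0 < C → LocallyIntegrable f μ →
      RbmoLocBound μ n η ρ β f C → ∀ x ∈ posBallSet (supMeasure μ),
      ∫⁻ y in closedBall x 1,
        ENNReal.ofReal (Real.exp (|f ((eucHomeo d).symm y)| / (C * K))) ∂supMeasure μ
        ≤ ENNReal.ofReal L := by
  have hρ : 1 < ρ := hη.trans_le hηρ
  have hβ1 : 1 < β := (one_le_pow₀ hρ.le).trans_lt hβ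
  have hlf := isLocallyFiniteMeasure_supMeasure (μ := μ)
  set ν := supMeasure μ with hν
  set G : ℝ := C₀ * 2 ^ n with hG
  have hG0 : 0 < G := by positivity
  have hgr : ∀ x ∈ posBallSet ν, ∀ r, 0 < r → ν.real (closedBall x r) ≤ G * r ^ n := by
    intro x hx r hr
    rw [hν, supMeasure_real_closedBall x hr.le]
    refine ENNReal.toReal_le_of_le_ofReal (by positivity)
      ((hgrowthQ _ (isCube_ballCube hr hx)).trans (le_of_eq ?_))
    rw [ballCube, mul_pow, hG, mul_assoc]
  obtain ⟨α, τ, κ, hα0, hα, hdoub, hchain⟩ := exists_doubling_radius_chain (S := posBallSet ν)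
    (m := fun x r => ν.real (closedBall x r)) n hρ hβ hG0
    (fun x a b hab => measureReal_mono (closedBall_subset_closedBall hab)
      measure_closedBall_lt_top.ne)
    (fun x y r hxy => measureReal_mono (closedBall_subset_closedBall' (by linarith))
      measure_closedBall_lt_top.ne)
    (fun x hx r hr => ENNReal.toReal_pos (hx r hr).ne' measure_closedBall_lt_top.ne) hgr
  set Λ : ℝ := 2 * η with hΛ
  obtain ⟨q, hq⟩ := pow_unbounded_of_one_lt (10 * Λ) (one_lt_two (α := ℝ))
  obtain ⟨A, hA, hcompare⟩ := hchain (G * 2 ^ (q * (d + 1)) * 4 ^ (n + 1)) (by positivity)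
  set T : ℝ := 4 * 2 ^ (q * (d + 1)) * (1 + 2 * (1 + A)) + 1 with hT
  have hT1 : 1 ≤ T := by
    rw [hT]
    have : 0 ≤ 4 * 2 ^ (q * (d + 1)) * (1 + 2 * (1 + A)) := by positivity
    linarith
  set l := Real.log (3 / 2) with hl
  have hl0 : 0 < l := Real.log_pos (by norm_num)
  set W : ℝ := G * (2 * Λ * 1) ^ n with hW
  have hW0 : 0 ≤ W := by positivity
  refine ⟨(1 + 2 * β) * T / l, 3 / 2 * (7 * W) + 1, by positivity, by linarith,
    fun f C hC hf hbd x hx => ?_⟩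
  obtain ⟨hF, hosc, hcmp, havg⟩ := hbd.ball_estimates hη hηρ (by linarith) hC.le hf hν rfl
  set F := f ∘ (eucHomeo d).symm with hFdef
  set M : ℝ := C * (1 + 2 * β) with hM
  have hM0 : 0 < M := by positivity
  set a : (Fin d → ℝ) → ℝ → ℝ := fun x s => ballAvg ν F x (2 ^ κ x s * τ x s) with ha
  have hτ0 : ∀ x ∈ posBallSet ν, ∀ s, 0 < s → 0 < τ x s := fun x hx s hs =>
    hs.trans_le (hdoub x hx s hs).1
  have hJN := two_pow_mul_measure_le (f := F) (a := a) (q := q) (Λ := Λ) (A := 2 * (1 + A)) (M := M)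
    hnd hα hG0 hM0 (by positivity) (by linarith) hq.le hF hgr ?_ ?_
  rotate_left
  · intro x hx s hs
    obtain ⟨h1, h2, h3, h4⟩ := hdoub x hx s hs
    refine (lintegral_enorm_sub_le_of_integral_le hF hM0.le h1
      (hosc x hx _ _ (hτ0 x hx s hs) h3 h4)).trans ?_
    refine mul_le_mul' le_rfl (measure_mono (closedBall_subset_closedBall ?_))
    rw [hΛ]; nlinarith
  · intro x hx y hy s t hs hst hxy hdec
    have ht : 0 < t := hs.trans_le hst
    obtain ⟨r, hr1, hr2, hr3, hr4, hr5⟩ := hcompare x hx y hy s t hs hst hxy hdec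
    have hpx : 0 < 2 ^ κ x s * τ x s := mul_pos (by positivity) (hτ0 x hx s hs)
    have hpy : 0 < 2 ^ κ y t * τ y t := mul_pos (by positivity) (hτ0 y hy t ht)
    have h1 := hcmp x hx y hy _ r hpx hr1 (hdoub x hx s hs).2.2.1 hr3
    have h2 := hcmp y hy y hy _ r hpy (by rwa [dist_self, zero_add]) (hdoub y hy t ht).2.2.1 hr3
    have h3 := abs_sub_le (a x s) (ballAvg ν F y r) (a y t)
    rw [abs_sub_comm (ballAvg ν F y r)] at h3
    calc |a x s - a y t| ≤ _ := h3
      _ ≤ M * (1 + A) + M * (1 + A) := add_le_add (h1.trans (by gcongr)) (h2.trans (by gcongr))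
      _ = _ := by ring
  have ha0 : |a x 1| ≤ C * β := by
    obtain ⟨h1, -, h3, -⟩ := hdoub x hx 1 one_pos
    refine havg x hx _ ?_ h3
    have : τ x 1 ≤ 2 ^ κ x 1 * τ x 1 :=
      le_mul_of_one_le_left (by linarith) (one_le_pow₀ one_le_two)
    linarith
  have hVW : ν (closedBall x (2 * Λ * 1)) ≤ ENNReal.ofReal W := by
    rw [← ofReal_measureReal (measure_closedBall_lt_top.ne)]
    exact ENNReal.ofReal_le_ofReal (hgr x hx _ (by positivity))
  have hexp := lintegral_exp_le_of_two_pow_mul_measure_le (ν := ν) (s := closedBall x 1)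
    (g := fun y => |F y - a x 1|) (c := M * T) measurableSet_closedBall
    ((hF.aestronglyMeasurable.restrict.aemeasurable.sub aemeasurable_const).norm) (by positivity)
    (fun k => (hJN k x hx 1 one_pos).trans hVW)
  have hball : ν (closedBall x 1) ≤ ENNReal.ofReal W :=
    (measure_mono (closedBall_subset_closedBall (by linarith))).trans hVW
  have hpt : ∀ y, Real.exp (|f ((eucHomeo d).symm y)| / (C * ((1 + 2 * β) * T / l)))
      ≤ 3 / 2 * Real.exp (l * (|F y - a x 1| / (M * T))) := by
    intro y
    rw [← Real.exp_log (show (0 : ℝ) < 3 / 2 by norm_num), ← Real.exp_add, Real.exp_le_exp]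
    have h1 : |F y| ≤ M * T + |F y - a x 1| := by
      have h2 := abs_sub_abs_le_abs_sub (F y) (a x 1)
      have h3 : C * β ≤ M * T := by
        rw [hM, mul_assoc]
        gcongr
        nlinarith
      linarith
    have hMT : 0 < M * T := by positivity
    calc |f ((eucHomeo d).symm y)| / (C * ((1 + 2 * β) * T / l)) = l * (|F y| / (M * T)) := by
          rw [hM, hFdef, Function.comp_apply]
          field_simp
      _ ≤ l * ((M * T + |F y - a x 1|) / (M * T)) := by gcongr
      _ = _ := by rw [add_div, div_self hMT.ne', mul_add, mul_one]
  calc _ ≤ ∫⁻ y in closedBall x 1, ENNReal.ofReal (3 / 2) *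
        ENNReal.ofReal (Real.exp (l * (|F y - a x 1| / (M * T)))) ∂ν :=
        lintegral_mono fun y => by
          rw [← ENNReal.ofReal_mul (by norm_num)]
          exact ENNReal.ofReal_le_ofReal (hpt y)
    _ = _ := lintegral_const_mul' _ _ ENNReal.ofReal_ne_top
    _ ≤ ENNReal.ofReal (3 / 2) * (ENNReal.ofReal W + 6 * ENNReal.ofReal W) := by
        gcongr
        exact hexp.trans (by gcongr)
    _ = ENNReal.ofReal (3 / 2 * (7 * W)) := by
        rw [ENNReal.ofReal_mul (p := 3 / 2) (by norm_num),
          ENNReal.ofReal_mul (p := 7) (by norm_num), ← one_add_mul, ENNReal.ofReal_ofNat 7]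
        norm_num
    _ ≤ _ := ENNReal.ofReal_le_ofReal (by linarith)

/-- exponential integrability of `rbmo(μ)` functions on cubes of side 1:
`∫_Q (exp(|f|/(c₇‖f‖_{rbmo})) − 1) dμ ≤ 1`. -/
theorem exp_integral_rbmoLoc_unit_cube
    {d n : ℕ} (μ : Measure (Euc d)) (C₀ η ρ β : ℝ)
    (hn : 0 < n) (hnd : n ≤ d) (hC₀ : 0 < C₀)
    (hgrowth : ∀ x : Euc d, ∀ r : ℝ, 0 < r →
      μ (Metric.ball x r) ≤ ENNReal.ofReal (C₀ * r ^ n))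
    (hgrowthQ : ∀ Q : Cube d, IsCube μ Q → μ Q.set ≤ ENNReal.ofReal (C₀ * Q.side ^ n))
    (hη : 1 < η) (hηρ : η ≤ ρ) (hρ : 1 < ρ) (hβ : ρ ^ n < β) :
    ∃ c₇ : ℝ, 0 < c₇ ∧
      ∀ Q : Cube d, IsCube μ Q → Q.side = 1 →
        ∀ f : Euc d → ℝ, MemRbmoLoc μ n η ρ β f → 0 < rbmoLocNorm μ n η ρ β f →
          ∫⁻ x in Q.set,
              ENNReal.ofReal
                (Real.exp (|f x| / (c₇ * rbmoLocNorm μ n η ρ β f)) - 1) ∂μ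
            ≤ 1 := by
  have hlf : IsLocallyFiniteMeasure μ := ⟨fun x => ⟨ball x 1, ball_mem_nhds x one_pos,
    (hgrowth x 1 one_pos).trans_lt ENNReal.ofReal_lt_top⟩⟩
  obtain ⟨K, L, hK, hL, hKL⟩ :=
    exists_lintegral_exp_le_of_rbmoLocBound μ hnd hC₀ hgrowthQ hη hηρ hβ
  refine ⟨2 * K * L, by positivity, fun Q hQ hside f hf hN => ?_⟩
  set N := rbmoLocNorm μ n η ρ β f with hNdef
  obtain ⟨C, ⟨hC0, hC⟩, hCN⟩ := exists_lt_of_csInf_lt (b := 2 * N) hf.2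
    (show rbmoLocNorm μ n η ρ β f < 2 * N by linarith)
  have hNC : N ≤ C := csInf_le ⟨0, fun _ h => h.1⟩ ⟨hC0, hC⟩
  have hCpos : 0 < C := hN.trans_le hNC
  have hcube : Q.set ⊆ eucHomeo d ⁻¹' closedBall (eucHomeo d Q.center) 1 := by
    rw [← ballCube_set _ zero_le_one]
    intro y hy i
    have h := hy i
    rw [hside] at h
    simp only [ballCube, Homeomorph.symm_apply_apply]
    linarith
  have hmap : ∫⁻ z in eucHomeo d ⁻¹' closedBall (eucHomeo d Q.center) 1,
      ENNReal.ofReal (Real.exp (|f z| / (C * K))) ∂μ ≤ ENNReal.ofReal L := by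
    have h := hKL f C hCpos hf.1 hC _ hQ.mem_posBallSet
    rw [supMeasure, (eucHomeo d).measurableEmbedding.restrict_map,
      (eucHomeo d).measurableEmbedding.lintegral_map] at h
    simpa only [Homeomorph.symm_apply_apply] using h
  refine le_trans ?_ (lintegral_exp_div_sub_one_le_one hL ((lintegral_mono_set hcube).trans hmap))
  refine lintegral_mono fun z => ENNReal.ofReal_le_ofReal ?_
  have hCK : C * K * L ≤ 2 * K * L * N := by
    nlinarith [mul_pos hK (zero_lt_one.trans_le hL)]
  rw [div_div]
  gcongr
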